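/- Suppose b satisfies Assumption 1 with ρ ∈ (1,2) and adopt the spectral setup. Then for every ε > 0 and T > 0 there exists C = C(T,ε) > 0 such that for every x with ‖x‖_{2+2ε} < ∞: ∫₀ᵀ ‖Ṡ(u)x‖₂ du = ∫₀ᵀ (Σ_k λ_k² (s_k′(u))² (x,e_k)²)^{1/2} du ≤ C ‖x‖_{2+2ε}. -/

import Mathlib

open MeasureTheory Filter Set
open scoped ENNReal NNReal RealInnerProductSpace

noncomputable section

/-- The Laplace transform `b̂(z) = ∫₀^∞ e^{-zt} b(t) dt` of a real-valued kernel `b`. -/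
def laplaceTransform (b : ℝ → ℝ) (z : ℂ) : ℂ :=
  ∫ t in Set.Ioi (0 : ℝ), Complex.exp (-z * t) * (b t : ℂ)

/-- Assumption 1: `b` is a nonzero, locally integrable, 3-monotone kernel
(with derivative `b'` on `(0,∞)`), `b(t) → 0` as `t → ∞`, and the angle condition
`ρ = 1 + (2/π) sup{|arg b̂(λ)| : Re λ > 0} ∈ (1,2)` holds. -/
structure Assumption1 (b b' : ℝ → ℝ) (ρ : ℝ) : Prop where
  locInt : ∀ T > 0, IntegrableOn b (Set.Ioc 0 T)
  ne_zero : ∃ t > 0, b t ≠ 0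
  nonneg : ∀ t > 0, 0 ≤ b t
  anti : AntitoneOn b (Set.Ioi 0)
  cvx : ConvexOn ℝ (Set.Ioi 0) b
  hasDeriv : ∀ t > 0, HasDerivAt b (b' t) t
  deriv_nonpos : ∀ t > 0, b' t ≤ 0
  deriv_anti : AntitoneOn (fun t => -(b' t)) (Set.Ioi 0)
  deriv_cvx : ConvexOn ℝ (Set.Ioi 0) (fun t => -(b' t))
  tendsto_zero : Tendsto b atTop (nhds 0)
  rho_eq : ρ = 1 + (2 / Real.pi) *
      sSup {θ : ℝ | ∃ z : ℂ, 0 < z.re ∧ θ = |(laplaceTransform b z).arg|}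
  rho_mem : ρ ∈ Set.Ioo (1 : ℝ) 2

/-- Assumption 2: `b̂` extends analytically to a sector `Σ_θ`, `θ > π/2`, with the
bounds `|b̂^{(k)}(z)| ≤ C |z|^{1-ρ-k}`, `k = 0,1`, there. -/
structure Assumption2 (b : ℝ → ℝ) (ρ θ : ℝ) : Prop where
  theta_gt : Real.pi / 2 < θ
  holo : ∃ B : ℂ → ℂ,
    (∀ z : ℂ, z ≠ 0 → |z.arg| < θ → DifferentiableAt ℂ B z) ∧
    (∀ z : ℂ, 0 < z.re → B z = laplaceTransform b z) ∧
    ∃ C > 0, (∀ z : ℂ, z ≠ 0 → |z.arg| < θ → ‖B z‖ ≤ C * ‖z‖ ^ (1 - ρ)) ∧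
      (∀ z : ℂ, z ≠ 0 → |z.arg| < θ → ‖deriv B z‖ ≤ C * ‖z‖ ^ (-ρ))

/-- `s` (with derivative `s'` on `(0,∞)`) solves the scalar Volterra equation
`s'(t) + λ ∫₀ᵗ b(t-u) s(u) du = 0`, `s(0) = 1`. -/
structure IsScalarSolution (b : ℝ → ℝ) (lam : ℝ) (s s' : ℝ → ℝ) : Prop where
  init : s 0 = 1
  cont : ContinuousOn s (Set.Ici 0)
  hasDeriv : ∀ t > 0, HasDerivAt s (s' t) t
  eqn : ∀ t > 0, s' t + lam * ∫ u in (0 : ℝ)..t, b (t - u) * s u = 0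

/-- The resolvent family `S(t)x = Σ_k s_k(t) (x,e_k) e_k`. -/
def Sop {H : Type*} [NormedAddCommGroup H] [InnerProductSpace ℝ H]
    (e : HilbertBasis ℕ ℝ H) (s : ℕ → ℝ → ℝ) (t : ℝ) (x : H) : H :=
  ∑' k, (s k t * ⟪x, e k⟫) • (e k : H)

/-- The Backward Euler convolution quadrature operator
`B_k = ∫₀^∞ F(Δt s) e^{-s} s^{k-1}/(k-1)! ds`. -/
def quadB {H : Type*} [NormedAddCommGroup H] [NormedSpace ℝ H]
    (Δt : ℝ) (F : ℝ → H) (k : ℕ) : H :=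
  ∫ u in Set.Ioi (0 : ℝ),
    (Real.exp (-u) * u ^ (k - 1) / (Nat.factorial (k - 1) : ℝ)) • F (Δt * u)

/-- The finite element setup: `f` is an orthonormal basis of the finite dimensional
subspace `V_h ⊆ D(A^{1/2})`, consisting of eigenvectors of the discrete operator `A_h`
(defined via the bilinear form `a(u,v) = Σ_k λ_k (u,e_k)(v,e_k)`) with positive
eigenvalues `μ`. -/
structure FESetup {H : Type*} [NormedAddCommGroup H] [InnerProductSpace ℝ H]
    (e : HilbertBasis ℕ ℝ H) (lam : ℕ → ℝ) (N : ℕ) (f : Fin N → H) (μ : Fin N → ℝ) :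
    Prop where
  f_orth : Orthonormal ℝ f
  mu_pos : ∀ j, 0 < μ j
  f_dom : ∀ j, (∑' k, ENNReal.ofReal (lam k * ⟪f j, e k⟫ ^ 2)) < ⊤
  eigen : ∀ j j', (∑' k, lam k * ⟪f j, e k⟫ * ⟪f j', e k⟫) = μ j * ⟪f j, f j'⟫

lemma norm_cexp_neg_mul (z : ℂ) (t : ℝ) : ‖Complex.exp (-z * t)‖ = Real.exp (-z.re * t) := by
  rw [Complex.norm_exp]; simp

lemma integrableOn_cexp_mul {f : ℝ → ℝ} {σ : ℝ}
    (hf : IntegrableOn (fun t => Real.exp (-σ * t) * f t) (Ioi 0)) {z : ℂ} (hz : σ ≤ z.re) :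
    IntegrableOn (fun t : ℝ => Complex.exp (-z * t) * (f t : ℂ)) (Ioi 0) := by
  have h1 : IntegrableOn (fun t : ℝ => Complex.exp (-(z - σ) * t) *
      ((Real.exp (-σ * t) * f t : ℝ) : ℂ)) (Ioi 0) := by
    refine Integrable.bdd_mul (c := 1) hf.ofReal (by fun_prop) ?_
    refine (ae_restrict_mem measurableSet_Ioi).mono fun t ht => ?_
    rw [norm_cexp_neg_mul]
    have h0 : 0 ≤ (z.re - σ) * t := mul_nonneg (by linarith) (le_of_lt ht)
    apply Real.exp_le_one_iff.2
    simp only [Complex.sub_re, Complex.ofReal_re]; linarith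
  refine h1.congr_fun (fun t _ => ?_) measurableSet_Ioi
  simp only [Complex.ofReal_mul, Complex.ofReal_exp, ← mul_assoc, ← Complex.exp_add]
  congr 2; push_cast; ring

lemma mul_exp_neg_le {c t : ℝ} (hc : 0 < c) : t * Real.exp (-c * t) ≤ 1 / c := by
  have h := Real.add_one_le_exp (c * t)
  rw [neg_mul, Real.exp_neg, ← div_eq_mul_inv, div_le_div_iff₀ (Real.exp_pos _) hc]
  linarith

lemma integrableOn_exp_mul_id_mul {f : ℝ → ℝ} {σ τ : ℝ}
    (hf : IntegrableOn (fun t => Real.exp (-σ * t) * f t) (Ioi 0)) (h : σ < τ) :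
    IntegrableOn (fun t => Real.exp (-τ * t) * (t * f t)) (Ioi 0) := by
  have h1 : IntegrableOn (fun t : ℝ => (t * Real.exp (-(τ - σ) * t)) *
      (Real.exp (-σ * t) * f t)) (Ioi 0) := by
    refine Integrable.bdd_mul (c := 1 / (τ - σ)) hf (by fun_prop) ?_
    refine (ae_restrict_mem measurableSet_Ioi).mono fun t ht => ?_
    rw [Real.norm_of_nonneg (mul_nonneg (le_of_lt ht) (Real.exp_nonneg _))]
    exact mul_exp_neg_le (by linarith)
  refine h1.congr_fun (fun t _ => ?_) measurableSet_Ioi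
  have : Real.exp (-τ * t) = Real.exp (-(τ - σ) * t) * Real.exp (-σ * t) := by
    rw [← Real.exp_add]; congr 1; ring
  simp only [this]; ring

lemma norm_laplaceTransform_le {f : ℝ → ℝ} {σ : ℝ}
    (hf : IntegrableOn (fun t => Real.exp (-σ * t) * f t) (Ioi 0)) {z : ℂ} (hz : σ ≤ z.re) :
    ‖laplaceTransform f z‖ ≤ ∫ t in Ioi 0, Real.exp (-σ * t) * |f t| := by
  unfold laplaceTransform
  refine norm_integral_le_of_norm_le ?_ ?_
  · refine IntegrableOn.congr_fun hf.norm (fun t _ => ?_) measurableSet_Ioi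
    simp
  · refine (ae_restrict_mem measurableSet_Ioi).mono fun t ht => ?_
    rw [norm_mul, norm_cexp_neg_mul, Complex.norm_real, Real.norm_eq_abs]
    gcongr
    exact le_of_lt ht

lemma hasDerivAt_laplaceTransform {f : ℝ → ℝ} {σ : ℝ}
    (hf : IntegrableOn (fun t => Real.exp (-σ * t) * f t) (Ioi 0)) {z : ℂ} (hz : σ < z.re) :
    HasDerivAt (laplaceTransform f) (-laplaceTransform (fun t => t * f t) z) z := by
  obtain ⟨τ, h1, h2⟩ := exists_between hz
  have hfm : AEStronglyMeasurable (fun t => (f t : ℂ)) (volume.restrict (Ioi 0)) := by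
    have : AEStronglyMeasurable (fun t => Real.exp (σ * t) * (Real.exp (-σ * t) * f t))
        (volume.restrict (Ioi 0)) :=
      (by fun_prop : Continuous fun t => Real.exp (σ * t)).aestronglyMeasurable.mul
        hf.aestronglyMeasurable
    refine (Complex.continuous_ofReal.comp_aestronglyMeasurable this).congr
      (Eventually.of_forall fun t => ?_)
    simp only [← mul_assoc, ← Real.exp_add]; simp
  have key := hasDerivAt_integral_of_dominated_loc_of_deriv_le (𝕜 := ℂ)
    (μ := volume.restrict (Ioi (0 : ℝ))) (s := {w : ℂ | τ < w.re}) (x₀ := z)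
    (F := fun w t => Complex.exp (-w * t) * (f t : ℂ))
    (F' := fun w t => -(Complex.exp (-w * t) * ((t * f t : ℝ) : ℂ)))
    (bound := fun t => ‖Real.exp (-τ * t) * (t * f t)‖)
    ((isOpen_lt continuous_const Complex.continuous_re).mem_nhds h2)
    (Eventually.of_forall fun w => (by fun_prop : Continuous fun t : ℝ =>
      Complex.exp (-w * t)).aestronglyMeasurable.mul hfm)
    (integrableOn_cexp_mul hf hz.le)
    (integrableOn_cexp_mul (integrableOn_exp_mul_id_mul hf h1) h2.le).neg.aestronglyMeasurable
    ?_ (integrableOn_exp_mul_id_mul hf h1).norm ?_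
  · have h := key.2
    rw [integral_neg] at h
    exact h
  · refine (ae_restrict_mem measurableSet_Ioi).mono fun t ht w hw => ?_
    rw [norm_neg, norm_mul, norm_cexp_neg_mul, Complex.norm_real, norm_mul (Real.exp _),
      Real.norm_of_nonneg (Real.exp_nonneg _)]
    gcongr
    · exact le_of_lt ht
    · exact le_of_lt hw
  · refine Eventually.of_forall fun t w _ => ?_
    have h : HasDerivAt (fun w : ℂ => -w * (t : ℂ)) (-1 * (t : ℂ)) w :=
      (hasDerivAt_id w).neg.mul_const _
    refine (h.cexp.mul_const (f t : ℂ)).congr_deriv ?_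
    push_cast; ring

lemma exists_superlevel_ae_eq_Ioc {d : ℝ → ℝ} (hd : AntitoneOn d (Ioi 0))
    (hlim : Tendsto d atTop (nhds 0)) {s : ℝ} (hs : 0 < s) :
    ∃ R, 0 ≤ R ∧ (Ioi 0 ∩ {t | s < d t} : Set ℝ) =ᵐ[volume] Ioc 0 R := by
  set A : Set ℝ := Ioi 0 ∩ {t | s < d t} with hA
  rcases A.eq_empty_or_nonempty with h | h
  · exact ⟨0, le_rfl, by simp [h]⟩
  obtain ⟨N, hN⟩ := eventually_atTop.1 (hlim.eventually (gt_mem_nhds hs))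
  have hbdd : BddAbove A := ⟨N, fun t ht => le_of_not_ge fun hle => lt_asymm (hN t hle) ht.2⟩
  have hR : 0 ≤ sSup A := by
    obtain ⟨t, ht⟩ := h
    exact (le_of_lt ht.1).trans (le_csSup hbdd ht)
  refine ⟨sSup A, hR, ?_⟩
  refine EventuallyLE.antisymm
    (LE.le.eventuallyLE (show A ≤ Ioc 0 (sSup A) from
      fun t ht => ⟨ht.1, le_csSup hbdd ht⟩)) ?_
  refine Ioo_ae_eq_Ioc.symm.le.trans
    (LE.le.eventuallyLE (show Ioo 0 (sSup A) ≤ A from fun t ht => ?_))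
  obtain ⟨u, hu, htu⟩ := exists_lt_of_lt_csSup h ht.2
  exact ⟨ht.1, lt_of_lt_of_le hu.2 (hd ht.1 hu.1 htu.le)⟩

lemma integrable_layer {E : Type*} [NormedAddCommGroup E] [NormedSpace ℝ E]
    {d : ℝ → ℝ} {k : ℝ → E} (hdm : Measurable d) (hd0 : ∀ t > 0, 0 ≤ d t) (hk : Continuous k)
    (hdk : IntegrableOn (fun t => d t • k t) (Ioi 0)) :
    Integrable ({p : ℝ × ℝ | p.2 < d p.1}.indicator fun p => k p.1)
      ((volume.restrict (Ioi 0)).prod (volume.restrict (Ioi 0))) := by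
  have hmeas : MeasurableSet {p : ℝ × ℝ | p.2 < d p.1} :=
    measurableSet_lt measurable_snd (hdm.comp measurable_fst)
  have hsm : AEStronglyMeasurable ({p : ℝ × ℝ | p.2 < d p.1}.indicator fun p => k p.1)
      ((volume.restrict (Ioi 0)).prod (volume.restrict (Ioi 0))) :=
    (hk.comp continuous_fst).aestronglyMeasurable.indicator hmeas
  refine (integrable_prod_iff hsm).2 ⟨?_, ?_⟩
  · refine (ae_restrict_mem measurableSet_Ioi).mono fun t _ => ?_
    have : (fun s => {p : ℝ × ℝ | p.2 < d p.1}.indicator (fun p => k p.1) (t, s)) =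
        (Iio (d t)).indicator fun _ => k t := by
      ext s; simp [indicator]
    rw [this, integrable_indicator_iff measurableSet_Iio, IntegrableOn,
      Measure.restrict_restrict measurableSet_Iio]
    exact integrableOn_const (by
      rw [inter_comm, Ioi_inter_Iio]; simp)
  · refine hdk.norm.congr ?_
    refine (ae_restrict_mem measurableSet_Ioi).mono fun t ht => ?_
    have : (fun s => ‖{p : ℝ × ℝ | p.2 < d p.1}.indicator (fun p => k p.1) (t, s)‖) =
        (Iio (d t)).indicator fun _ => ‖k t‖ := by
      ext s; by_cases h : s < d t <;> simp [indicator, h]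
    show _ = _
    beta_reduce
    rw [this, setIntegral_indicator measurableSet_Iio, Ioi_inter_Iio]
    simp [norm_smul, abs_of_nonneg (hd0 t ht), ENNReal.toReal_ofReal (hd0 t ht), Measure.real]

lemma setIntegral_smul_eq_layer {E : Type*} [NormedAddCommGroup E] [NormedSpace ℝ E] [CompleteSpace E]
    {d : ℝ → ℝ} {k : ℝ → E} (hdm : Measurable d) (hd0 : ∀ t > 0, 0 ≤ d t) (hk : Continuous k)
    (hdk : IntegrableOn (fun t => d t • k t) (Ioi 0)) :
    ∫ t in Ioi 0, d t • k t = ∫ s in Ioi 0, ∫ t in Ioi 0 ∩ {t | s < d t}, k t := by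
  have h := integral_integral_swap (f := fun t s =>
    {p : ℝ × ℝ | p.2 < d p.1}.indicator (fun p => k p.1) (t, s)) (integrable_layer hdm hd0 hk hdk)
  refine Eq.trans ?_ (h.trans ?_)
  · refine setIntegral_congr_fun measurableSet_Ioi fun t ht => ?_
    have : (fun s => {p : ℝ × ℝ | p.2 < d p.1}.indicator (fun p => k p.1) (t, s)) =
        (Iio (d t)).indicator fun _ => k t := by
      ext s; simp [indicator]
    rw [this, setIntegral_indicator measurableSet_Iio, Ioi_inter_Iio]
    simp [ENNReal.toReal_ofReal (hd0 t ht), Measure.real]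
  · refine setIntegral_congr_fun measurableSet_Ioi fun s _ => ?_
    have : (fun t => {p : ℝ × ℝ | p.2 < d p.1}.indicator (fun p => k p.1) (t, s)) =
        {t | s < d t}.indicator k := by
      ext t; simp [indicator]
    rw [this, setIntegral_indicator (measurableSet_lt measurable_const hdm)]

/-- A monotone weight preserves domination of primitives. -/
lemma norm_setIntegral_antitone_smul_le {E : Type*} [NormedAddCommGroup E] [NormedSpace ℝ E] [CompleteSpace E]
    {d w : ℝ → ℝ} {k : ℝ → E} (hdm : Measurable d) (hd0 : ∀ t > 0, 0 ≤ d t)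
    (hd : AntitoneOn d (Ioi 0)) (hlim : Tendsto d atTop (nhds 0))
    (hk : Continuous k) (hw : Continuous w)
    (hdk : IntegrableOn (fun t => d t • k t) (Ioi 0))
    (hdw : IntegrableOn (fun t => d t * w t) (Ioi 0))
    (h : ∀ R ≥ 0, ‖∫ t in (0 : ℝ)..R, k t‖ ≤ ∫ t in (0 : ℝ)..R, w t) :
    ‖∫ t in Ioi 0, d t • k t‖ ≤ ∫ t in Ioi 0, d t * w t := by
  have e2 := setIntegral_smul_eq_layer hdm hd0 hw hdw
  simp only [smul_eq_mul] at e2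
  rw [setIntegral_smul_eq_layer hdm hd0 hk hdk, e2]
  refine norm_integral_le_of_norm_le ?_ ?_
  · refine (integrable_layer hdm hd0 hw hdw).integral_prod_right.congr
      (Eventually.of_forall fun s => ?_)
    have : (fun t => {p : ℝ × ℝ | p.2 < d p.1}.indicator (fun p => w p.1) (t, s)) =
        {t | s < d t}.indicator w := by
      ext t; simp [indicator]
    show _ = _
    beta_reduce
    rw [this, setIntegral_indicator (measurableSet_lt measurable_const hdm)]
  · refine (ae_restrict_mem measurableSet_Ioi).mono fun s hs => ?_
    obtain ⟨R, hR, hae⟩ := exists_superlevel_ae_eq_Ioc hd hlim hs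
    rw [setIntegral_congr_set hae, setIntegral_congr_set hae,
      ← intervalIntegral.integral_of_le hR, ← intervalIntegral.integral_of_le hR]
    exact h R hR

lemma norm_cexp_neg_I_mul (y t : ℝ) : ‖Complex.exp (-(Complex.I * y * t))‖ = 1 := by
  rw [Complex.norm_exp]; simp

lemma min_sq_linear_le_trig {r : ℝ} (hr : 0 ≤ r) :
    r ^ 2 / 2 ≤ 3 * (r - Real.sin r + (1 - Real.cos r)) ∨
      r + 2 ≤ 3 * (r - Real.sin r + (1 - Real.cos r)) := by
  rcases le_total r Real.pi with h | h
  · left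
    have h1 := Real.cos_le_one_sub_mul_cos_sq (x := r) (by rwa [abs_of_nonneg hr])
    have h2 := Real.sin_le hr
    have h3 : Real.pi ^ 2 ≤ 12 := by nlinarith [Real.pi_lt_d2, Real.pi_pos]
    have h4 : r ^ 2 / 2 ≤ 3 * (2 / Real.pi ^ 2 * r ^ 2) := by
      have : (1 : ℝ) / 6 ≤ 2 / Real.pi ^ 2 := by
        rw [div_le_div_iff₀ (by norm_num) (by positivity)]; linarith
      nlinarith [sq_nonneg r]
    linarith
  · right
    have := Real.pi_gt_three
    linarith [Real.sin_le_one r, Real.cos_le_one r]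

lemma norm_integral_mul_cexp_le {y R : ℝ} (hy : y ≠ 0) (hR : 0 ≤ R) :
    ‖∫ t in (0 : ℝ)..R, (t : ℂ) * Complex.exp (-(Complex.I * y * t))‖ ≤
      3 / y ^ 2 * (|y| * R - Real.sin (|y| * R) + (1 - Real.cos (|y| * R))) := by
  have hy2 : 0 < y ^ 2 := by positivity
  have key : ‖∫ t in (0 : ℝ)..R, (t : ℂ) * Complex.exp (-(Complex.I * y * t))‖ ≤
      (|y| * R) ^ 2 / 2 / y ^ 2 := by
    have h1 : ‖∫ t in (0 : ℝ)..R, (t : ℂ) * Complex.exp (-(Complex.I * y * t))‖ ≤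
        ∫ t in (0 : ℝ)..R, t := by
      refine intervalIntegral.norm_integral_le_of_norm_le hR ?_
        (continuous_id.intervalIntegrable _ _)
      refine Eventually.of_forall fun t ht => ?_
      rw [norm_mul, norm_cexp_neg_I_mul, Complex.norm_real, mul_one,
        Real.norm_of_nonneg ht.1.le]
    refine h1.trans (le_of_eq ?_)
    rw [integral_id, mul_pow, sq_abs]
    field_simp
    ring
  have key2 : ‖∫ t in (0 : ℝ)..R, (t : ℂ) * Complex.exp (-(Complex.I * y * t))‖ ≤
      (|y| * R + 2) / y ^ 2 := by
    have hyc : (y : ℂ) ≠ 0 := by exact_mod_cast hy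
    have h1 : ∫ t in (0 : ℝ)..R, (t : ℂ) * Complex.exp (-(Complex.I * y * t)) =
        (Complex.I * y * R + 1) / y ^ 2 * Complex.exp (-(Complex.I * y * R)) - 1 / y ^ 2 := by
      have hd : ∀ t ∈ uIcc 0 R, HasDerivAt (fun t : ℝ => (Complex.I * y * t + 1) / y ^ 2 *
          Complex.exp (-(Complex.I * y * t))) ((t : ℂ) * Complex.exp (-(Complex.I * y * t))) t := by
        intro t _
        have h0 : HasDerivAt (fun t : ℝ => Complex.I * y * (t : ℂ)) (Complex.I * y * 1) t :=
          (Complex.ofRealCLM.hasDerivAt (x := t)).const_mul _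
        refine (((h0.add_const 1).div_const _).mul h0.neg.cexp).congr_deriv ?_
        field_simp
        linear_combination (-(y : ℂ) * t * Complex.exp (-(Complex.I * y * t))) * Complex.I_sq
      rw [intervalIntegral.integral_eq_sub_of_hasDerivAt hd
        (Continuous.intervalIntegrable (by fun_prop) _ _)]
      simp
    rw [h1]
    refine (norm_sub_le _ _).trans ?_
    have h2 : ‖(y : ℂ) ^ 2‖ = y ^ 2 := by
      rw [norm_pow, Complex.norm_real, Real.norm_eq_abs, sq_abs]
    have h3 : ‖Complex.I * y * R + 1‖ ≤ |y| * R + 1 := by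
      refine (norm_add_le _ _).trans ?_
      simp [abs_of_nonneg hR]
    rw [norm_mul, norm_cexp_neg_I_mul, mul_one, norm_div, norm_div, h2, norm_one, ← add_div]
    refine div_le_div_of_nonneg_right ?_ hy2.le
    linarith
  rw [div_mul_eq_mul_div]
  rcases min_sq_linear_le_trig (mul_nonneg (abs_nonneg y) hR) with h | h
  · exact key.trans (by gcongr)
  · exact key2.trans (by gcongr)

lemma integral_trig_weight {y R : ℝ} (hy : y ≠ 0) :
    ∫ t in (0 : ℝ)..R, 3 / |y| * ((1 - Real.cos (|y| * t)) + Real.sin (|y| * t)) =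
      3 / y ^ 2 * (|y| * R - Real.sin (|y| * R) + (1 - Real.cos (|y| * R))) := by
  have hy' : |y| ≠ 0 := abs_ne_zero.2 hy
  have hd : ∀ t ∈ uIcc 0 R, HasDerivAt (fun t : ℝ => 3 / |y| ^ 2 *
      (|y| * t - Real.sin (|y| * t) - Real.cos (|y| * t)))
      (3 / |y| * ((1 - Real.cos (|y| * t)) + Real.sin (|y| * t))) t := by
    intro t _
    have h0 : HasDerivAt (fun t : ℝ => |y| * t) (|y| * 1) t := (hasDerivAt_id t).const_mul _
    refine (((h0.sub h0.sin).sub h0.cos).const_mul _).congr_deriv ?_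
    field_simp
    ring
  rw [intervalIntegral.integral_eq_sub_of_hasDerivAt hd
    (Continuous.intervalIntegrable (by fun_prop) _ _)]
  simp only [mul_zero, Real.sin_zero, Real.cos_zero, sq_abs]
  ring

namespace Assumption1

variable {b b' : ℝ → ℝ} {ρ : ℝ}

lemma continuousOn (hb : Assumption1 b b' ρ) : ContinuousOn b (Ioi 0) := fun t ht =>
  (hb.hasDeriv t ht).continuousAt.continuousWithinAt

lemma continuousOn_deriv (hb : Assumption1 b b' ρ) : ContinuousOn b' (Ioi 0) := by
  exact (hb.deriv_cvx.continuousOn isOpen_Ioi).neg.congr fun t _ => (neg_neg _).symm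

lemma integrableOn_exp_mul (hb : Assumption1 b b' ρ) {σ : ℝ} (hσ : 0 < σ) :
    IntegrableOn (fun t => Real.exp (-σ * t) * b t) (Ioi 0) := by
  rw [← Ioc_union_Ioi_eq_Ioi (zero_le_one' ℝ)]
  refine IntegrableOn.union ?_ ?_
  · refine Integrable.bdd_mul (c := 1) (hb.locInt 1 one_pos) (by fun_prop) ?_
    refine (ae_restrict_mem measurableSet_Ioc).mono fun t ht => ?_
    rw [Real.norm_of_nonneg (Real.exp_nonneg _)]
    exact Real.exp_le_one_iff.2 (by nlinarith [ht.1])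
  · have h1 : IntegrableOn (fun t => Real.exp (-σ * t)) (Ioi 1) :=
      integrableOn_exp_mul_Ioi (by linarith) 1
    refine Integrable.mul_bdd (c := b 1) h1 ?_ ?_
    · exact (hb.continuousOn.mono (Ioi_subset_Ioi zero_le_one)).aestronglyMeasurable
        measurableSet_Ioi
    · refine (ae_restrict_mem measurableSet_Ioi).mono fun t (ht : 1 < t) => ?_
      have h0 : (0 : ℝ) < t := by linarith
      rw [Real.norm_of_nonneg (hb.nonneg t h0)]
      exact hb.anti (mem_Ioi.2 one_pos) h0 ht.le

lemma tendsto_mul_self_zero (hb : Assumption1 b b' ρ) :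
    Tendsto (fun t => t * b t) (nhdsWithin 0 (Ioi 0)) (nhds 0) := by
  have hint : IntegrableOn b (Icc 0 1) := by
    rw [integrableOn_Icc_iff_integrableOn_Ioc]; exact hb.locInt 1 one_pos
  have h1 : Tendsto (fun t => ∫ u in (0 : ℝ)..t, b u) (nhdsWithin 0 (Ioi 0)) (nhds 0) := by
    have h := intervalIntegral.continuousOn_primitive_interval (a := (0 : ℝ)) (b := 1) (f := b)
      (μ := volume) (by rwa [uIcc_of_le zero_le_one])
    have h0 := h 0 (by simp)
    rw [uIcc_of_le zero_le_one] at h0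
    have h2 := h0.tendsto
    rw [intervalIntegral.integral_same] at h2
    exact h2.mono_left (by
      rw [← nhdsWithin_Ioc_eq_nhdsGT (zero_lt_one' ℝ)]
      exact nhdsWithin_mono _ Ioc_subset_Icc_self)
  refine tendsto_of_tendsto_of_tendsto_of_le_of_le' tendsto_const_nhds h1 ?_ ?_
  · filter_upwards [self_mem_nhdsWithin] with t ht
    exact mul_nonneg (le_of_lt ht) (hb.nonneg t ht)
  · filter_upwards [self_mem_nhdsWithin] with t (ht : 0 < t)
    have h3 : ∫ _ in (0 : ℝ)..t, b t ≤ ∫ u in (0 : ℝ)..t, b u := by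
      refine intervalIntegral.integral_mono_on_of_le_Ioo ht.le intervalIntegrable_const ?_ ?_
      · rw [intervalIntegrable_iff_integrableOn_Ioc_of_le ht.le]; exact hb.locInt t ht
      · intro u hu
        exact hb.anti hu.1 ht hu.2.le
    simpa using h3

/-- Minus the derivative of `t ↦ exp (-x t) * b t`. -/
def dampedSlope (b b' : ℝ → ℝ) (x : ℝ) : ℝ → ℝ :=
  (Ioi 0).indicator fun t => Real.exp (-x * t) * (x * b t - b' t)

lemma measurable_dampedSlope (hb : Assumption1 b b' ρ) (x : ℝ) :
    Measurable (dampedSlope b b' x) := by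
  have h : ContinuousOn (fun t => Real.exp (-x * t) * (x * b t - b' t)) (Ioi 0) :=
    (by fun_prop : Continuous fun t => Real.exp (-x * t)).continuousOn.mul
      ((continuousOn_const.mul hb.continuousOn).sub hb.continuousOn_deriv)
  have := h.measurable_piecewise (g := fun _ => (0 : ℝ)) continuousOn_const measurableSet_Ioi
  exact this

lemma dampedSlope_nonneg (hb : Assumption1 b b' ρ) {x : ℝ} (hx : 0 < x) (t : ℝ) :
    0 ≤ dampedSlope b b' x t := by
  refine indicator_nonneg (fun t ht => ?_) t
  have h1 := hb.nonneg t ht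
  have h2 := hb.deriv_nonpos t ht
  have : 0 ≤ x * b t - b' t := by nlinarith
  positivity

lemma dampedSlope_antitoneOn (hb : Assumption1 b b' ρ) {x : ℝ} (hx : 0 < x) :
    AntitoneOn (dampedSlope b b' x) (Ioi 0) := by
  intro s hs t ht hst
  simp only [dampedSlope, indicator_of_mem hs, indicator_of_mem ht]
  have h1 := hb.nonneg t ht
  have h2 := hb.deriv_nonpos t ht
  have h3 := hb.anti hs ht hst
  have h4 : -(b' t) ≤ -(b' s) := hb.deriv_anti hs ht hst
  have h5 : 0 ≤ x * b t - b' t := by nlinarith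
  refine mul_le_mul (Real.exp_le_exp.2 (by nlinarith)) (by nlinarith) h5 (Real.exp_nonneg _)

lemma tendsto_dampedSlope (hb : Assumption1 b b' ρ) {x : ℝ} (hx : 0 < x) :
    Tendsto (dampedSlope b b' x) atTop (nhds 0) := by
  have h1 : Tendsto (fun t => Real.exp (-x * t) * (x * b 1 - b' 1)) atTop (nhds 0) := by
    have : Tendsto (fun t => Real.exp (-x * t)) atTop (nhds 0) :=
      Real.tendsto_exp_atBot.comp (tendsto_id.const_mul_atTop_of_neg (by linarith))
    simpa using this.mul_const (x * b 1 - b' 1)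
  refine tendsto_of_tendsto_of_tendsto_of_le_of_le' tendsto_const_nhds h1
    (Eventually.of_forall fun t => hb.dampedSlope_nonneg hx t) ?_
  filter_upwards [eventually_ge_atTop 1] with t ht
  have ht0 : t ∈ Ioi (0 : ℝ) := lt_of_lt_of_le one_pos ht
  have h3 := hb.anti (mem_Ioi.2 one_pos) ht0 ht
  have h4 : -(b' t) ≤ -(b' 1) := hb.deriv_anti (mem_Ioi.2 one_pos) ht0 ht
  simp only [dampedSlope, indicator_of_mem ht0]
  gcongr
  nlinarith

lemma hasDerivAt_damped (hb : Assumption1 b b' ρ) (x : ℝ) {t : ℝ} (ht : 0 < t) :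
    HasDerivAt (fun t => Real.exp (-x * t) * b t) (-dampedSlope b b' x t) t := by
  have h0 : HasDerivAt (fun t => -x * t) (-x * 1) t := (hasDerivAt_id t).const_mul _
  refine (h0.exp.mul (hb.hasDeriv t ht)).congr_deriv ?_
  simp only [dampedSlope, indicator_of_mem (mem_Ioi.2 ht)]
  ring

lemma tendsto_mul_damped_zero (hb : Assumption1 b b' ρ) (x : ℝ) :
    Tendsto (fun t => t * (Real.exp (-x * t) * b t)) (nhdsWithin 0 (Ioi 0)) (nhds 0) := by
  have h1 : Tendsto (fun t => Real.exp (-x * t)) (nhdsWithin 0 (Ioi 0)) (nhds 1) := by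
    have : Continuous fun t => Real.exp (-x * t) := by fun_prop
    simpa using (this.tendsto 0).mono_left nhdsWithin_le_nhds
  simpa [mul_left_comm] using h1.mul hb.tendsto_mul_self_zero

lemma tendsto_mul_damped_atTop (hb : Assumption1 b b' ρ) {x : ℝ} (hx : 0 < x) :
    Tendsto (fun t => t * (Real.exp (-x * t) * b t)) atTop (nhds 0) := by
  have h1 : Tendsto (fun t => t * Real.exp (-x * t)) atTop (nhds 0) := by
    have h := Real.tendsto_pow_mul_exp_neg_atTop_nhds_zero 1
    have h2 := (h.comp (tendsto_id.const_mul_atTop hx)).const_mul (1 / x)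
    simp only [mul_zero] at h2
    refine h2.congr fun t => ?_
    simp only [Function.comp, id, pow_one, neg_mul]
    field_simp
  have := h1.mul hb.tendsto_zero
  simpa [mul_assoc] using this

lemma integrableOn_mul_dampedSlope (hb : Assumption1 b b' ρ) {x : ℝ} (hx : 0 < x) :
    IntegrableOn (fun t => dampedSlope b b' x t * t) (Ioi 0) := by
  set c : ℝ → ℝ := fun t => Real.exp (-x * t) * b t with hc
  have hcint : IntegrableOn c (Ioi 0) := hb.integrableOn_exp_mul hx
  have hcc : ContinuousOn c (Ioi 0) :=
    (by fun_prop : Continuous fun t => Real.exp (-x * t)).continuousOn.mul hb.continuousOn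
  have hci : ∀ t, 0 ≤ t → IntervalIntegrable c volume 0 t := fun t ht => by
    rw [intervalIntegrable_iff_integrableOn_Ioc_of_le ht]
    exact hcint.mono_set Ioc_subset_Ioi_self
  have hprim : Tendsto (fun t => ∫ u in (0 : ℝ)..t, c u) (nhdsWithin 0 (Ici 0)) (nhds 0) := by
    have h := intervalIntegral.continuousOn_primitive_interval (a := (0 : ℝ)) (b := 1) (f := c)
      (μ := volume) (by
        rw [uIcc_of_le zero_le_one, integrableOn_Icc_iff_integrableOn_Ioc]
        exact hcint.mono_set Ioc_subset_Ioi_self)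
    have h0 := (h 0 (by simp)).tendsto
    rw [uIcc_of_le zero_le_one, intervalIntegral.integral_same,
      nhdsWithin_Icc_eq_nhdsGE (zero_lt_one' ℝ)] at h0
    exact h0
  refine integrableOn_Ioi_deriv_of_nonneg (l := (∫ u in Ioi 0, c u) - 0)
    (g := fun t => (∫ u in (0 : ℝ)..t, c u) - t * c t) ?_ ?_ ?_ ?_
  · have h2 : Tendsto (fun t => t * c t) (nhdsWithin 0 (Ici 0)) (nhds 0) := by
      rw [← Ioi_insert, nhdsWithin_insert, tendsto_sup]
      refine ⟨?_, hb.tendsto_mul_damped_zero x⟩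
      simpa using tendsto_pure_nhds (fun t => t * c t) 0
    have := hprim.sub h2
    simpa [ContinuousWithinAt] using this
  · intro t (ht : 0 < t)
    have h1 : HasDerivAt (fun t => ∫ u in (0 : ℝ)..t, c u) (c t) t :=
      intervalIntegral.integral_hasDerivAt_right (hci t ht.le)
        (hcc.stronglyMeasurableAtFilter isOpen_Ioi t ht) (hcc.continuousAt (Ioi_mem_nhds ht))
    refine (h1.sub ((hasDerivAt_id t).mul (hb.hasDerivAt_damped x ht))).congr_deriv ?_
    simp only [id, hc]; ring
  · intro t ht
    exact mul_nonneg (hb.dampedSlope_nonneg hx t) (le_of_lt ht)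
  · exact (intervalIntegral_tendsto_integral_Ioi 0 hcint tendsto_id).sub
      (hb.tendsto_mul_damped_atTop hx)

end Assumption1

namespace Assumption1

variable {b b' : ℝ → ℝ} {ρ : ℝ}

lemma integrableOn_dampedSlope_smul (hb : Assumption1 b b' ρ) {x : ℝ} (hx : 0 < x)
    {E : Type*} [NormedAddCommGroup E] [NormedSpace ℝ E] {k : ℝ → E} {C : ℝ} (hk : Continuous k)
    (hkC : ∀ t > 0, ‖k t‖ ≤ C * t) :
    IntegrableOn (fun t => dampedSlope b b' x t • k t) (Ioi 0) := by
  refine Integrable.mono' ((hb.integrableOn_mul_dampedSlope hx).const_mul C)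
    ((hb.measurable_dampedSlope x).aestronglyMeasurable.smul hk.aestronglyMeasurable) ?_
  refine (ae_restrict_mem measurableSet_Ioi).mono fun t ht => ?_
  have h0 := hb.dampedSlope_nonneg hx t
  rw [norm_smul, Real.norm_of_nonneg h0]
  nlinarith [mul_le_mul_of_nonneg_left (hkC t ht) h0]

/-- Integration by parts against the damped kernel. -/
lemma integral_damped_deriv (hb : Assumption1 b b' ρ) {x : ℝ} (hx : 0 < x) {u u' : ℝ → ℂ}
    {C : ℝ} (hu : ∀ t, HasDerivAt u (u' t) t) (huC : ∀ t > 0, ‖u t‖ ≤ C * t)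
    (hint : IntegrableOn (fun t => u' t * ((Real.exp (-x * t) * b t : ℝ) : ℂ)) (Ioi 0)) :
    ∫ t in Ioi 0, u' t * ((Real.exp (-x * t) * b t : ℝ) : ℂ) =
      ∫ t in Ioi 0, dampedSlope b b' x t • u t := by
  have hucont : Continuous u := continuous_iff_continuousAt.2 fun t => (hu t).continuousAt
  have hd := hb.integrableOn_dampedSlope_smul hx hucont huC
  have hbound : ∀ t > 0, ‖u t * ((Real.exp (-x * t) * b t : ℝ) : ℂ)‖ ≤
      C * (t * (Real.exp (-x * t) * b t)) := by
    intro t ht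
    have h0 : 0 ≤ Real.exp (-x * t) * b t := mul_nonneg (Real.exp_nonneg _) (hb.nonneg t ht)
    rw [norm_mul, Complex.norm_real, Real.norm_of_nonneg h0]
    have := mul_le_mul_of_nonneg_right (huC t ht) h0
    linarith
  have key := integral_Ioi_deriv_mul_eq_sub (a := (0 : ℝ)) (u := u) (u' := u')
    (v := fun t => ((Real.exp (-x * t) * b t : ℝ) : ℂ))
    (v' := fun t => ((-dampedSlope b b' x t : ℝ) : ℂ)) (a' := 0) (b' := 0)
    (fun t _ => hu t) (fun t ht => (hb.hasDerivAt_damped x ht).ofReal_comp) ?_ ?_ ?_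
  · rw [sub_zero] at key
    have h2 : ∀ t, u' t * ((Real.exp (-x * t) * b t : ℝ) : ℂ) +
        u t * ((-dampedSlope b b' x t : ℝ) : ℂ) =
        u' t * ((Real.exp (-x * t) * b t : ℝ) : ℂ) - dampedSlope b b' x t • u t := by
      intro t; rw [Complex.real_smul]; push_cast; ring
    simp only [h2] at key
    rw [integral_sub hint hd] at key
    exact sub_eq_zero.1 key
  · refine (hint.sub hd).congr (Eventually.of_forall fun t => ?_)
    simp only [Pi.sub_apply, Pi.add_apply, Pi.mul_apply, Complex.real_smul]
    push_cast; ring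
  · refine squeeze_zero_norm' (a := fun t => C * (t * (Real.exp (-x * t) * b t))) ?_ ?_
    · filter_upwards [self_mem_nhdsWithin] with t ht using hbound t ht
    · simpa using (hb.tendsto_mul_damped_zero x).const_mul C
  · refine squeeze_zero_norm' (a := fun t => C * (t * (Real.exp (-x * t) * b t))) ?_ ?_
    · filter_upwards [eventually_gt_atTop 0] with t ht using hbound t ht
    · simpa using (hb.tendsto_mul_damped_atTop hx).const_mul C

lemma integrableOn_exp_mul_id (hb : Assumption1 b b' ρ) {σ : ℝ} (hσ : 0 < σ) :
    IntegrableOn (fun t => Real.exp (-σ * t) * (t * b t)) (Ioi 0) :=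
  integrableOn_exp_mul_id_mul (hb.integrableOn_exp_mul (half_pos hσ)) (half_lt_self hσ)

lemma damped_kernel_eq (b : ℝ → ℝ) (x y t : ℝ) :
    Complex.exp (-(x + Complex.I * y) * t) * (b t : ℂ) =
      Complex.exp (-(Complex.I * y * t)) * ((Real.exp (-x * t) * b t : ℝ) : ℂ) := by
  push_cast
  rw [← mul_assoc, ← Complex.exp_add]
  congr 2; ring

lemma norm_one_sub_cexp_le (y t : ℝ) : ‖1 - Complex.exp (-(Complex.I * y * t))‖ ≤ |y| * |t| := by
  have h := Real.norm_exp_I_mul_ofReal_sub_one_le (x := -(y * t))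
  rw [norm_sub_rev]
  convert h using 1
  · congr 3; push_cast; ring
  · rw [norm_neg, Real.norm_eq_abs, abs_mul]

lemma hasDerivAt_cexp_neg_I (y t : ℝ) : HasDerivAt (fun t : ℝ => Complex.exp (-(Complex.I * y * t)))
    (-(Complex.I * y) * Complex.exp (-(Complex.I * y * t))) t := by
  have h0 : HasDerivAt (fun t : ℝ => Complex.I * y * (t : ℂ)) (Complex.I * y * 1) t :=
    (Complex.ofRealCLM.hasDerivAt (x := t)).const_mul _
  refine h0.neg.cexp.congr_deriv ?_
  simp only [Pi.neg_apply]
  ring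

lemma integrableOn_cexp_mul_kernel (hb : Assumption1 b b' ρ) {x : ℝ} (hx : 0 < x) (y : ℝ) :
    IntegrableOn (fun t : ℝ => Complex.exp (-(x + Complex.I * y) * t) * (b t : ℂ)) (Ioi 0) :=
  integrableOn_cexp_mul (hb.integrableOn_exp_mul hx) (by simp)

lemma integrableOn_cexp_mul_id_kernel (hb : Assumption1 b b' ρ) {x : ℝ} (hx : 0 < x) (y : ℝ) :
    IntegrableOn (fun t : ℝ => Complex.exp (-(x + Complex.I * y) * t) * ((t * b t : ℝ) : ℂ))
      (Ioi 0) :=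
  integrableOn_cexp_mul (hb.integrableOn_exp_mul_id hx) (by simp)

lemma I_mul_laplaceTransform_eq (hb : Assumption1 b b' ρ) {x : ℝ} (hx : 0 < x) (y : ℝ) :
    Complex.I * y * laplaceTransform b (x + Complex.I * y) =
      ∫ t in Ioi 0, dampedSlope b b' x t • (1 - Complex.exp (-(Complex.I * y * t))) := by
  have e : ∀ t : ℝ, Complex.I * y * (Complex.exp (-(x + Complex.I * y) * t) * (b t : ℂ)) =
      (Complex.I * y * Complex.exp (-(Complex.I * y * t))) *
        ((Real.exp (-x * t) * b t : ℝ) : ℂ) := fun t => by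
    rw [damped_kernel_eq]; ring
  rw [← hb.integral_damped_deriv hx (C := |y|)
    (u' := fun t => Complex.I * y * Complex.exp (-(Complex.I * y * t)))]
  · rw [laplaceTransform, ← integral_const_mul]
    simp only [e]
  · intro t
    refine ((hasDerivAt_cexp_neg_I y t).const_sub 1).congr_deriv (by ring)
  · intro t ht
    simpa [abs_of_pos ht] using norm_one_sub_cexp_le y t
  · have h := (hb.integrableOn_cexp_mul_kernel hx y).const_mul (Complex.I * y)
    simp only [e] at h
    exact h

lemma laplaceTransform_sub_eq (hb : Assumption1 b b' ρ) {x : ℝ} (hx : 0 < x) (y : ℝ) :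
    laplaceTransform b (x + Complex.I * y) -
        Complex.I * y * laplaceTransform (fun t => t * b t) (x + Complex.I * y) =
      ∫ t in Ioi 0, dampedSlope b b' x t • ((t : ℂ) * Complex.exp (-(Complex.I * y * t))) := by
  have e : ∀ t : ℝ, Complex.exp (-(x + Complex.I * y) * t) * (b t : ℂ) -
      Complex.I * y * (Complex.exp (-(x + Complex.I * y) * t) * ((t * b t : ℝ) : ℂ)) =
      (Complex.exp (-(Complex.I * y * t)) - Complex.I * y * t *
        Complex.exp (-(Complex.I * y * t))) * ((Real.exp (-x * t) * b t : ℝ) : ℂ) := fun t => by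
    have h := damped_kernel_eq b x y t
    rw [Complex.ofReal_mul t]
    linear_combination (1 - Complex.I * y * t) * h
  have h1 := hb.integrableOn_cexp_mul_kernel hx y
  have h2 := (hb.integrableOn_cexp_mul_id_kernel hx y).const_mul (Complex.I * y)
  rw [← hb.integral_damped_deriv hx (C := 1)
    (u' := fun t => Complex.exp (-(Complex.I * y * t)) - Complex.I * y * t *
        Complex.exp (-(Complex.I * y * t)))]
  · rw [laplaceTransform, laplaceTransform, ← integral_const_mul, ← integral_sub h1 h2]
    simp only [e]
  · intro t
    refine ((Complex.ofRealCLM.hasDerivAt (x := t)).mul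
      (hasDerivAt_cexp_neg_I y t)).congr_deriv ?_
    simp only [Complex.ofRealCLM_apply, Complex.ofReal_one]
    ring
  · intro t ht
    rw [norm_mul, norm_cexp_neg_I_mul, Complex.norm_real, Real.norm_of_nonneg (le_of_lt ht)]
    linarith
  · simpa only [Pi.sub_def, e] using h1.sub h2

lemma abs_mul_norm_laplaceTransform_id_le (hb : Assumption1 b b' ρ) {x : ℝ} (hx : 0 < x) {y : ℝ}
    (hy : y ≠ 0) :
    |y| * ‖laplaceTransform (fun t => t * b t) (x + Complex.I * y)‖ ≤
      7 * ‖laplaceTransform b (x + Complex.I * y)‖ := by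
  set P := laplaceTransform b (x + Complex.I * y) with hP
  set Q := laplaceTransform (fun t => t * b t) (x + Complex.I * y) with hQ
  obtain ⟨σ, hσ, hσy⟩ : ∃ σ : ℝ, |σ| = 1 ∧ ∀ t, Real.sin (|y| * t) = σ * Real.sin (y * t) := by
    rcases abs_choice y with h | h
    · exact ⟨1, by simp, fun t => by simp [h]⟩
    · exact ⟨-1, by simp, fun t => by simp [h]⟩
  have hcos : ∀ t, Real.cos (|y| * t) = Real.cos (y * t) := fun t => by
    rcases abs_choice y with h | h <;> simp [h]
  set φ : ℂ →L[ℝ] ℝ := (3 / |y|) • (Complex.reCLM + σ • Complex.imCLM) with hφ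
  have hφP : ∀ z, φ z ≤ 3 / |y| * (2 * ‖z‖) := by
    intro z
    have h1 := Complex.re_le_norm z
    have h2 : σ * z.im ≤ ‖z‖ := by
      refine (le_abs_self _).trans ?_
      rw [abs_mul, hσ, one_mul]; exact Complex.abs_im_le_norm z
    simp only [hφ, smul_apply, add_apply,
      Complex.reCLM_apply, Complex.imCLM_apply, smul_eq_mul]
    gcongr
    linarith
  have hw : ∀ t : ℝ, φ (1 - Complex.exp (-(Complex.I * y * t))) =
      3 / |y| * ((1 - Real.cos (|y| * t)) + Real.sin (|y| * t)) := by
    intro t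
    have e : -(Complex.I * y * t) = ((-(y * t) : ℝ) : ℂ) * Complex.I := by push_cast; ring
    simp only [hφ, smul_apply, add_apply,
      Complex.reCLM_apply, Complex.imCLM_apply, smul_eq_mul, e, Complex.sub_re, Complex.sub_im,
      Complex.exp_ofReal_mul_I_re, Complex.exp_ofReal_mul_I_im, Complex.one_re, Complex.one_im,
      Real.cos_neg, Real.sin_neg, hσy, hcos]
    ring
  have hint := hb.integrableOn_dampedSlope_smul hx (C := |y|)
    (k := fun t => 1 - Complex.exp (-(Complex.I * y * t))) (by fun_prop)
    (fun t ht => by simpa [abs_of_pos ht] using norm_one_sub_cexp_le y t)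
  have hint2 := hb.integrableOn_dampedSlope_smul hx (C := 1)
    (k := fun t => (t : ℂ) * Complex.exp (-(Complex.I * y * t))) (by fun_prop)
    (fun t ht => by
      rw [norm_mul, norm_cexp_neg_I_mul, Complex.norm_real, Real.norm_of_nonneg (le_of_lt ht)]
      linarith)
  have e3 : ∀ t : ℝ, φ (dampedSlope b b' x t • (1 - Complex.exp (-(Complex.I * y * t)))) =
      dampedSlope b b' x t * (3 / |y| * ((1 - Real.cos (|y| * t)) + Real.sin (|y| * t))) :=
    fun t => by rw [map_smul, hw, smul_eq_mul]
  have hφint := φ.integrable_comp hint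
  simp only [e3] at hφint
  have main := norm_setIntegral_antitone_smul_le (hb.measurable_dampedSlope x)
    (fun t _ => hb.dampedSlope_nonneg hx t) (hb.dampedSlope_antitoneOn hx)
    (hb.tendsto_dampedSlope hx)
    (k := fun t : ℝ => (t : ℂ) * Complex.exp (-(Complex.I * y * t)))
    (w := fun t => 3 / |y| * ((1 - Real.cos (|y| * t)) + Real.sin (|y| * t)))
    (by fun_prop) (by fun_prop) hint2 hφint
    (fun R hR => by
      rw [integral_trig_weight hy]; exact norm_integral_mul_cexp_le hy hR)
  rw [← hb.laplaceTransform_sub_eq hx y] at main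
  have e4 : ∫ t in Ioi 0, dampedSlope b b' x t *
      (3 / |y| * ((1 - Real.cos (|y| * t)) + Real.sin (|y| * t))) = φ (Complex.I * y * P) := by
    rw [hP, hb.I_mul_laplaceTransform_eq hx y, ← φ.integral_comp_comm hint]
    simp only [e3]
  rw [e4] at main
  have h5 := hφP (Complex.I * y * P)
  have hy' : 0 < |y| := abs_pos.2 hy
  have h6 : 3 / |y| * (2 * ‖Complex.I * y * P‖) = 6 * ‖P‖ := by
    rw [norm_mul, norm_mul, Complex.norm_I, Complex.norm_real, Real.norm_eq_abs]
    field_simp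
    ring
  have h7 : |y| * ‖Q‖ = ‖Complex.I * y * Q‖ := by
    rw [norm_mul, norm_mul, Complex.norm_I, Complex.norm_real, Real.norm_eq_abs, one_mul]
  have h8 : ‖Complex.I * y * Q‖ ≤ ‖P‖ + ‖P - Complex.I * y * Q‖ := by
    have := norm_sub_le P (P - Complex.I * y * Q)
    rwa [sub_sub_cancel] at this
  linarith [norm_nonneg P]

end Assumption1

namespace Assumption1

variable {b b' : ℝ → ℝ} {ρ : ℝ}

lemma laplaceTransform_ofReal_re_pos (hb : Assumption1 b b' ρ) {x : ℝ} (hx : 0 < x) :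
    0 < (laplaceTransform b x).re := by
  have e : laplaceTransform b x = ((∫ t in Ioi 0, Real.exp (-x * t) * b t : ℝ) : ℂ) := by
    rw [laplaceTransform, ← integral_complex_ofReal]
    refine integral_congr_ae (Eventually.of_forall fun t => ?_)
    push_cast; rfl
  rw [e, Complex.ofReal_re]
  obtain ⟨t₀, ht₀, hne⟩ := hb.ne_zero
  have hpos : 0 < b t₀ := lt_of_le_of_ne (hb.nonneg t₀ ht₀) (Ne.symm hne)
  have hnn : 0 ≤ᵐ[volume.restrict (Ioi 0)] fun t => Real.exp (-x * t) * b t :=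
    (ae_restrict_mem measurableSet_Ioi).mono fun t ht =>
      mul_nonneg (Real.exp_nonneg _) (hb.nonneg t ht)
  rw [integral_pos_iff_support_of_nonneg_ae hnn (hb.integrableOn_exp_mul hx)]
  rw [Measure.restrict_apply']
  · refine lt_of_lt_of_le ?_ (measure_mono (s := Ioc 0 t₀) ?_)
    · rw [Real.volume_Ioc]; simpa using ht₀
    · intro t ht
      have : 0 < b t := hpos.trans_le (hb.anti ht.1 ht₀ ht.2)
      exact ⟨(mul_pos (Real.exp_pos _) this).ne', ht.1⟩
  · exact measurableSet_Ioi

lemma exists_sector (hb : Assumption1 b b' ρ) :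
    ∃ κ > 0, ∀ z : ℂ, 0 < z.re → κ * ‖laplaceTransform b z‖ ≤ (laplaceTransform b z).re := by
  set S := {θ : ℝ | ∃ z : ℂ, 0 < z.re ∧ θ = |(laplaceTransform b z).arg|} with hS
  have hbdd : BddAbove S := ⟨Real.pi, by
    rintro θ ⟨z, -, rfl⟩; exact Complex.abs_arg_le_pi _⟩
  have hlt : sSup S < Real.pi / 2 := by
    have h1 := hb.rho_eq
    have h2 := hb.rho_mem.2
    rw [← hS] at h1
    have h3 : 2 / Real.pi * sSup S < 1 := by linarith
    have hpi := Real.pi_pos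
    rw [div_mul_eq_mul_div, div_lt_one hpi] at h3
    linarith
  have h0 : 0 ≤ sSup S := Real.sSup_nonneg (by rintro θ ⟨z, -, rfl⟩; exact abs_nonneg _)
  refine ⟨Real.cos (sSup S), Real.cos_pos_of_mem_Ioo ⟨by linarith [Real.pi_pos], hlt⟩, ?_⟩
  intro z hz
  have h4 : |(laplaceTransform b z).arg| ≤ sSup S := le_csSup hbdd ⟨z, hz, rfl⟩
  have h5 : Real.cos (sSup S) ≤ Real.cos (laplaceTransform b z).arg := by
    rw [← Real.cos_abs (laplaceTransform b z).arg]
    exact Real.cos_le_cos_of_nonneg_of_le_pi (abs_nonneg _) (by linarith [Real.pi_pos]) h4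
  calc _ ≤ Real.cos (laplaceTransform b z).arg * ‖laplaceTransform b z‖ := by gcongr
    _ = _ := by rw [mul_comm, Complex.norm_mul_cos_arg]

/-- The kernel is `1`-regular along vertical lines. -/
lemma exists_regular (hb : Assumption1 b b' ρ) {x : ℝ} (hx : 0 < x) :
    ∃ C > 0, ∀ z : ℂ, z.re = x →
      ‖z‖ * ‖laplaceTransform (fun t => t * b t) z‖ ≤ C * ‖laplaceTransform b z‖ := by
  have hx0 : 0 < ‖laplaceTransform b x‖ :=
    (hb.laplaceTransform_ofReal_re_pos hx).trans_le (Complex.re_le_norm _)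
  have hcont : ContinuousAt (fun y : ℝ => ‖laplaceTransform b (x + Complex.I * y)‖) 0 := by
    have h1 : ContinuousAt (laplaceTransform b) ((fun y : ℝ => (x + Complex.I * y : ℂ)) 0) :=
      (hasDerivAt_laplaceTransform (hb.integrableOn_exp_mul (half_pos hx))
        (by simpa using half_lt_self hx)).continuousAt
    exact (ContinuousAt.comp (f := fun y : ℝ => (x + Complex.I * y : ℂ)) h1 (by fun_prop)).norm
  have hlt : ‖laplaceTransform b x‖ / 2 < ‖laplaceTransform b (x + Complex.I * (0 : ℝ))‖ := by
    simpa using half_lt_self hx0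
  obtain ⟨η, hη, hball⟩ := Metric.eventually_nhds_iff.1 (hcont.eventually (lt_mem_nhds hlt))
  set γ := ∫ t in Ioi 0, Real.exp (-x * t) * |t * b t| with hγ
  have hγ0 : 0 ≤ γ := integral_nonneg fun t => mul_nonneg (Real.exp_nonneg _) (abs_nonneg _)
  have hC1 : 0 ≤ (x + η) * γ / (‖laplaceTransform b x‖ / 2) := by positivity
  refine ⟨(x + η) * γ / (‖laplaceTransform b x‖ / 2) + (1 + x / η) * 7, by positivity, ?_⟩
  intro z hz
  set y := z.im with hy
  have hz' : z = x + Complex.I * y := by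
    rw [← hz, hy, mul_comm, Complex.re_add_im]
  have hnz : ‖z‖ ≤ x + |y| := by
    have := Complex.norm_le_abs_re_add_abs_im z
    rwa [hz, abs_of_pos hx] at this
  have hQ : ‖laplaceTransform (fun t => t * b t) z‖ ≤ γ :=
    norm_laplaceTransform_le (hb.integrableOn_exp_mul_id hx) hz.ge
  have hP0 := norm_nonneg (laplaceTransform b z)
  rw [add_mul]
  rcases lt_or_ge |y| η with h | h
  · have h1 := hball (y := y) (by simpa [Real.dist_eq] using h)
    rw [← hz'] at h1
    have h2 : ‖z‖ * ‖laplaceTransform (fun t => t * b t) z‖ ≤ (x + η) * γ := by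
      gcongr; linarith
    have h3 : (x + η) * γ ≤
        (x + η) * γ / (‖laplaceTransform b x‖ / 2) * ‖laplaceTransform b z‖ := by
      rw [div_mul_eq_mul_div, le_div_iff₀ (by positivity)]
      gcongr
    have h4 : 0 ≤ (1 + x / η) * 7 * ‖laplaceTransform b z‖ := by positivity
    linarith
  · have hy0 : y ≠ 0 := by
      intro h0; rw [h0, abs_zero] at h; linarith
    have h1 := hb.abs_mul_norm_laplaceTransform_id_le hx hy0
    rw [← hz'] at h1
    have h2 : ‖z‖ ≤ (1 + x / η) * |y| := by
      have : x ≤ x / η * |y| := by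
        rw [div_mul_eq_mul_div, le_div_iff₀ hη]; gcongr
      linarith
    have h3 : ‖z‖ * ‖laplaceTransform (fun t => t * b t) z‖ ≤
        (1 + x / η) * 7 * ‖laplaceTransform b z‖ := by
      calc _ ≤ (1 + x / η) * |y| * ‖laplaceTransform (fun t => t * b t) z‖ := by gcongr
        _ = (1 + x / η) * (|y| * ‖laplaceTransform (fun t => t * b t) z‖) := by ring
        _ ≤ (1 + x / η) * (7 * ‖laplaceTransform b z‖) := by gcongr
        _ = _ := by ring
    have h4 := mul_nonneg hC1 hP0
    linarith

end Assumption1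

/-- The Laplace transform of `s'` for the solution `s` of the scalar Volterra equation. -/
def slopeSymbol (b : ℝ → ℝ) (lam : ℝ) (z : ℂ) : ℂ :=
  -(lam * laplaceTransform b z) / (z + lam * laplaceTransform b z)

/-- The derivative of `slopeSymbol`. -/
def slopeSymbolDeriv (b : ℝ → ℝ) (lam : ℝ) (z : ℂ) : ℂ :=
  lam * (z * laplaceTransform (fun t => t * b t) z + laplaceTransform b z) /
    (z + lam * laplaceTransform b z) ^ 2

lemma one_add_abs_im_le {z : ℂ} (hz : 1 ≤ z.re) : 1 + |z.im| ≤ 2 * ‖z‖ := by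
  have h1 := Complex.re_le_norm z
  have h2 := Complex.abs_im_le_norm z
  linarith

lemma le_rpow_interpolate {X M l r δ : ℝ} (hM : 0 ≤ M) (hl : 0 < l) (hr : 0 < r)
    (hX : 0 ≤ X) (h1 : X ≤ M / r) (h2 : X ≤ M * l / r ^ 2) (hδ : 0 < δ) (hδ1 : δ < 1) :
    X ≤ M * l ^ δ * r ^ (-(1 + δ)) := by
  have e : X = X ^ (1 - δ) * X ^ δ := by
    rw [← Real.rpow_add' hX (by norm_num)]; norm_num
  have hδ' : 0 ≤ 1 - δ := by linarith
  calc X = X ^ (1 - δ) * X ^ δ := e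
    _ ≤ (M / r) ^ (1 - δ) * (M * l / r ^ 2) ^ δ := by gcongr
    _ = (M ^ (1 - δ) * M ^ δ) * l ^ δ * (r ^ (-(1 - δ)) * r ^ (-(2 * δ))) := by
      rw [Real.div_rpow hM hr.le, Real.div_rpow (by positivity) (by positivity),
        Real.mul_rpow hM hl.le, Real.rpow_neg hr.le, Real.rpow_neg hr.le, Real.rpow_mul hr.le,
        Real.rpow_two]
      ring
    _ = _ := by
      rw [← Real.rpow_add' hM (by norm_num), ← Real.rpow_add hr]
      congr 2 <;> [norm_num; ring_nf]

namespace Assumption1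

variable {b b' : ℝ → ℝ} {ρ : ℝ}

lemma exists_norm_denom (hb : Assumption1 b b' ρ) :
    ∃ κ > (0 : ℝ), ∀ lam > (0 : ℝ), ∀ z : ℂ, 0 < z.re →
      κ * (lam * ‖laplaceTransform b z‖) ≤ ‖z + lam * laplaceTransform b z‖ ∧
      κ * ‖z‖ ≤ ‖z + lam * laplaceTransform b z‖ ∧ z + lam * laplaceTransform b z ≠ 0 := by
  obtain ⟨κ, hκ, h⟩ := hb.exists_sector
  refine ⟨κ / (1 + κ), by positivity, fun lam hlam z hz => ?_⟩
  set P := laplaceTransform b z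
  set D := z + lam * P with hD
  have hP0 := norm_nonneg P
  have hre : z.re + lam * (κ * ‖P‖) ≤ ‖D‖ := by
    have h1 := Complex.re_le_norm D
    have h2 : D.re = z.re + lam * P.re := by simp [hD]
    have h3 := mul_le_mul_of_nonneg_left (h z hz) hlam.le
    linarith
  have hk : κ / (1 + κ) ≤ κ := div_le_self hκ.le (by linarith)
  have hlP : 0 ≤ lam * ‖P‖ := by positivity
  refine ⟨?_, ?_, ?_⟩
  · have := mul_le_mul_of_nonneg_right hk hlP
    linarith
  · have h1 : ‖z‖ ≤ ‖D‖ + lam * ‖P‖ := by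
      have h4 : z = D - lam * P := by rw [hD]; ring
      calc ‖z‖ = ‖D - lam * P‖ := by rw [← h4]
        _ ≤ ‖D‖ + ‖lam * P‖ := norm_sub_le _ _
        _ = _ := by rw [norm_mul, Complex.norm_real, Real.norm_of_nonneg hlam.le]
    rw [div_mul_eq_mul_div, div_le_iff₀ (by positivity)]
    nlinarith
  · rw [← norm_pos_iff]
    have : 0 ≤ lam * (κ * ‖P‖) := by positivity
    linarith

lemma hasDerivAt_slopeSymbol (hb : Assumption1 b b' ρ) {lam : ℝ} (hlam : 0 < lam) {z : ℂ}
    (hz : 0 < z.re) : HasDerivAt (slopeSymbol b lam) (slopeSymbolDeriv b lam z) z := by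
  obtain ⟨κ, -, h⟩ := hb.exists_norm_denom
  have hne := (h lam hlam z hz).2.2
  have hP := (hasDerivAt_laplaceTransform (hb.integrableOn_exp_mul (half_pos hz))
    (half_lt_self hz)).const_mul (lam : ℂ)
  refine (hP.neg.div ((hasDerivAt_id z).add hP) hne).congr_deriv ?_
  simp only [slopeSymbolDeriv, Pi.neg_apply, Pi.add_apply, id]
  congr 1
  ring

lemma differentiableOn_slopeSymbolDeriv (hb : Assumption1 b b' ρ) {lam : ℝ} (hlam : 0 < lam) :
    DifferentiableOn ℂ (slopeSymbolDeriv b lam) {z | 0 < z.re} := by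
  have hopen : IsOpen {z : ℂ | 0 < z.re} := isOpen_lt continuous_const Complex.continuous_re
  have h1 : DifferentiableOn ℂ (slopeSymbol b lam) {z | 0 < z.re} := fun z hz =>
    (hb.hasDerivAt_slopeSymbol hlam hz).differentiableAt.differentiableWithinAt
  refine (h1.deriv hopen).congr fun z hz => ?_
  exact (hb.hasDerivAt_slopeSymbol hlam hz).deriv.symm

lemma exists_norm_slopeSymbolDeriv_le (hb : Assumption1 b b' ρ) {x δ : ℝ} (hx : 1 ≤ x)
    (hδ : 0 < δ) (hδ1 : δ < 1) :
    ∃ C > 0, ∀ lam > 0, ∀ z : ℂ, z.re = x →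
      ‖slopeSymbolDeriv b lam z‖ ≤ C * lam ^ δ * (1 + |z.im|) ^ (-(1 + δ)) := by
  have hx0 : 0 < x := by linarith
  obtain ⟨κ, hκ, hden⟩ := hb.exists_norm_denom
  obtain ⟨R, hR, hreg⟩ := hb.exists_regular hx0
  set β := ∫ t in Ioi 0, Real.exp (-x * t) * |b t| with hβ
  have hβ0 : 0 ≤ β := integral_nonneg fun t => mul_nonneg (Real.exp_nonneg _) (abs_nonneg _)
  set M := (R + 1) * (1 + β) / κ ^ 2 with hM
  have hM0 : 0 < M := by positivity
  refine ⟨M * 2 ^ (1 + δ), by positivity, fun lam hlam z hz => ?_⟩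
  obtain ⟨h1, h2, h3⟩ := hden lam hlam z (by rw [hz]; exact hx0)
  have hr := hreg z hz
  have hP : ‖laplaceTransform b z‖ ≤ β :=
    norm_laplaceTransform_le (hb.integrableOn_exp_mul hx0) hz.ge
  have hzr := one_add_abs_im_le (z := z) (by rw [hz]; exact hx)
  have hy0 := abs_nonneg z.im
  have hz0 : 0 < ‖z‖ := by linarith
  set P := laplaceTransform b z
  set Q := laplaceTransform (fun t => t * b t) z
  set D := z + lam * P
  have hD0 : 0 < ‖D‖ := norm_pos_iff.2 h3
  have hP0 := norm_nonneg P
  have hX : ‖slopeSymbolDeriv b lam z‖ ≤ (R + 1) * (lam * ‖P‖) / ‖D‖ ^ 2 := by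
    rw [slopeSymbolDeriv, norm_div, norm_pow, norm_mul, Complex.norm_real,
      Real.norm_of_nonneg hlam.le]
    have h5 : ‖z * Q + P‖ ≤ (R + 1) * ‖P‖ := by
      refine (norm_add_le _ _).trans ?_
      rw [norm_mul]; linarith
    have h6 : lam * ‖z * Q + P‖ ≤ (R + 1) * (lam * ‖P‖) :=
      (mul_le_mul_of_nonneg_left h5 hlam.le).trans_eq (by ring)
    exact div_le_div_of_nonneg_right h6 (by positivity)
  have hA : (R + 1) * (lam * ‖P‖) / ‖D‖ ^ 2 ≤ M / ‖z‖ := by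
    have h7 : lam * ‖P‖ ≤ ‖D‖ / κ := by rw [le_div_iff₀ hκ]; linarith
    calc _ ≤ (R + 1) * (‖D‖ / κ) / ‖D‖ ^ 2 := by gcongr
      _ = (R + 1) / (κ * ‖D‖) := by field_simp
      _ ≤ (R + 1) / (κ * (κ * ‖z‖)) := by gcongr
      _ = (R + 1) * 1 / κ ^ 2 / ‖z‖ := by field_simp
      _ ≤ M / ‖z‖ := by rw [hM]; gcongr; linarith
  have hB : (R + 1) * (lam * ‖P‖) / ‖D‖ ^ 2 ≤ M * lam / ‖z‖ ^ 2 := by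
    calc _ ≤ (R + 1) * (lam * (1 + β)) / (κ * ‖z‖) ^ 2 := by gcongr; linarith
      _ = _ := by rw [hM]; field_simp
  refine (le_rpow_interpolate hM0.le hlam hz0 (norm_nonneg _) (hX.trans hA) (hX.trans hB)
    hδ hδ1).trans ?_
  have h8 : ‖z‖ ^ (-(1 + δ)) ≤ 2 ^ (1 + δ) * (1 + |z.im|) ^ (-(1 + δ)) := by
    have h9 : ((1 + |z.im|) / 2) ^ (-(1 + δ)) = 2 ^ (1 + δ) * (1 + |z.im|) ^ (-(1 + δ)) := by
      rw [Real.div_rpow (by positivity) (by norm_num), Real.rpow_neg (by norm_num : (0 : ℝ) ≤ 2)]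
      field_simp
    rw [← h9]
    exact Real.rpow_le_rpow_of_nonpos (by positivity) (by linarith) (by linarith)
  calc _ ≤ M * lam ^ δ * (2 ^ (1 + δ) * (1 + |z.im|) ^ (-(1 + δ))) := by gcongr
    _ = _ := by ring

lemma exists_norm_slopeSymbolDeriv_le_inv (hb : Assumption1 b b' ρ) {lam : ℝ} (hlam : 0 < lam) :
    ∃ C > 0, ∀ z : ℂ, 1 ≤ z.re → ‖slopeSymbolDeriv b lam z‖ ≤ C / (1 + |z.im|) := by
  obtain ⟨κ, hκ, hden⟩ := hb.exists_norm_denom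
  set β := ∫ t in Ioi 0, Real.exp (-1 * t) * |b t| with hβ
  have hβ0 : 0 ≤ β := integral_nonneg fun t => mul_nonneg (Real.exp_nonneg _) (abs_nonneg _)
  set γ := ∫ t in Ioi 0, Real.exp (-1 * t) * |t * b t| with hγ
  have hγ0 : 0 ≤ γ := integral_nonneg fun t => mul_nonneg (Real.exp_nonneg _) (abs_nonneg _)
  refine ⟨2 * (lam * (γ + β + 1) / κ ^ 2), by positivity, fun z hz => ?_⟩
  obtain ⟨-, h2, -⟩ := hden lam hlam z (by linarith)
  have hP : ‖laplaceTransform b z‖ ≤ β :=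
    norm_laplaceTransform_le (hb.integrableOn_exp_mul one_pos) hz
  have hQ : ‖laplaceTransform (fun t => t * b t) z‖ ≤ γ :=
    norm_laplaceTransform_le (hb.integrableOn_exp_mul_id one_pos) hz
  have hzr := one_add_abs_im_le hz
  have hz1 : 1 ≤ ‖z‖ := hz.trans (Complex.re_le_norm z)
  have hy0 := abs_nonneg z.im
  have hz0 : 0 < ‖z‖ := by linarith
  rw [slopeSymbolDeriv, norm_div, norm_pow, norm_mul, Complex.norm_real,
      Real.norm_of_nonneg hlam.le]
  have h5 : ‖z * laplaceTransform (fun t => t * b t) z + laplaceTransform b z‖ ≤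
      (γ + β + 1) * ‖z‖ := by
    refine (norm_add_le _ _).trans ?_
    rw [norm_mul]
    nlinarith [mul_le_mul_of_nonneg_left hQ hz0.le]
  calc _ ≤ lam * ((γ + β + 1) * ‖z‖) / (κ * ‖z‖) ^ 2 := by gcongr
    _ = lam * (γ + β + 1) / κ ^ 2 / ‖z‖ := by field_simp
    _ ≤ lam * (γ + β + 1) / κ ^ 2 / ((1 + |z.im|) / 2) := by gcongr; linarith
    _ = _ := by field_simp

end Assumption1

namespace IsScalarSolution

variable {b b' s s' : ℝ → ℝ} {ρ lam : ℝ}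

lemma abs_slope_le_of_abs_le (hs : IsScalarSolution b lam s s') (hb : Assumption1 b b' ρ)
    (hlam : 0 < lam) {ω m t : ℝ} (hω : 1 ≤ ω) (ht : 0 < t)
    (hm : ∀ u ∈ Icc 0 t, |s u| ≤ m * Real.exp (ω * u)) :
    |s' t| ≤ lam * (∫ v in Ioi 0, Real.exp (-1 * v) * b v) * m * Real.exp (ω * t) := by
  have hm0 : 0 ≤ m := by
    have := (abs_nonneg _).trans (hm 0 ⟨le_rfl, ht.le⟩)
    simpa using this
  have hconv : ∫ u in (0 : ℝ)..t, b (t - u) * s u = ∫ v in Ioc 0 t, b v * s (t - v) := by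
    have := intervalIntegral.integral_comp_sub_left (fun v => b v * s (t - v)) t (a := 0) (b := t)
    simp only [sub_sub_cancel, sub_self, sub_zero] at this
    rw [this, intervalIntegral.integral_of_le ht.le]
  have h1 : s' t = -(lam * ∫ v in Ioc 0 t, b v * s (t - v)) := by
    have := hs.eqn t ht
    rw [hconv] at this; linarith
  have hint : IntegrableOn (fun v => Real.exp (-1 * v) * b v) (Ioc 0 t) :=
    (hb.integrableOn_exp_mul one_pos).mono_set Ioc_subset_Ioi_self
  have h2 : |∫ v in Ioc 0 t, b v * s (t - v)| ≤
      ∫ v in Ioc 0 t, m * Real.exp (ω * t) * (Real.exp (-1 * v) * b v) := by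
    rw [← Real.norm_eq_abs]
    refine norm_integral_le_of_norm_le (hint.const_mul _) ?_
    refine (ae_restrict_mem measurableSet_Ioc).mono fun v hv => ?_
    have hb0 := hb.nonneg v hv.1
    rw [norm_mul, Real.norm_of_nonneg hb0, Real.norm_eq_abs]
    calc b v * |s (t - v)| ≤ b v * (m * Real.exp (ω * (t - v))) := by
          gcongr; exact hm _ ⟨by linarith [hv.2], by linarith [hv.1]⟩
      _ ≤ b v * (m * (Real.exp (ω * t) * Real.exp (-1 * v))) := by
          rw [← Real.exp_add]; gcongr; nlinarith [hv.1]
      _ = _ := by ring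
  rw [h1, abs_neg, abs_mul, abs_of_pos hlam]
  rw [integral_const_mul] at h2
  have h3 : ∫ v in Ioc 0 t, Real.exp (-1 * v) * b v ≤ ∫ v in Ioi 0, Real.exp (-1 * v) * b v :=
    setIntegral_mono_set (hb.integrableOn_exp_mul one_pos)
      ((ae_restrict_mem measurableSet_Ioi).mono fun v hv =>
        mul_nonneg (Real.exp_nonneg _) (hb.nonneg v hv))
      (LE.le.eventuallyLE Ioc_subset_Ioi_self)
  calc _ ≤ lam * (m * Real.exp (ω * t) * ∫ v in Ioc 0 t, Real.exp (-1 * v) * b v) := by gcongr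
    _ ≤ lam * (m * Real.exp (ω * t) * ∫ v in Ioi 0, Real.exp (-1 * v) * b v) := by gcongr
    _ = _ := by ring

/-- Comparison: if `|s'| ≤ c ω e^{ωt}`, then `|s| ≤ |s 0| + c (e^{ωt} - 1)`. -/
lemma abs_sub_le_of_abs_slope_le (hs : IsScalarSolution b lam s s') {ω c t : ℝ}
    (ht : 0 ≤ t) (h : ∀ u ∈ Ioo 0 t, |s' u| ≤ c * (ω * Real.exp (ω * u))) :
    |s t| ≤ 1 + c * (Real.exp (ω * t) - 1) := by
  have key : ∀ σ : ℝ, |σ| = 1 → σ * s t ≤ 1 + c * (Real.exp (ω * t) - 1) := by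
    intro σ hσ
    have hd : ∀ u ∈ Ioo 0 t, HasDerivAt (fun u => c * Real.exp (ω * u) - σ * s u)
        (c * (ω * Real.exp (ω * u)) - σ * s' u) u := by
      intro u hu
      have h1 : HasDerivAt (fun u : ℝ => Real.exp (ω * u)) (Real.exp (ω * u) * (ω * 1)) u :=
        ((hasDerivAt_id u).const_mul ω).exp
      exact ((h1.congr_deriv (by ring)).const_mul c).sub ((hs.hasDeriv u hu.1).const_mul σ)
    have hmono : MonotoneOn (fun u => c * Real.exp (ω * u) - σ * s u) (Icc 0 t) := by
      refine monotoneOn_of_deriv_nonneg (convex_Icc _ _) ?_ ?_ ?_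
      · refine ContinuousOn.sub (by fun_prop) ((hs.cont.mono Icc_subset_Ici_self).const_mul σ)
      · rw [interior_Icc]
        exact fun u hu => (hd u hu).differentiableAt.differentiableWithinAt
      · rw [interior_Icc]
        intro u hu
        rw [(hd u hu).deriv]
        have h2 := le_abs_self (σ * s' u)
        rw [abs_mul, hσ, one_mul] at h2
        linarith [h u hu]
    have h3 := hmono ⟨le_rfl, ht⟩ ⟨ht, le_rfl⟩ ht
    simp only [mul_zero, Real.exp_zero, hs.init] at h3
    have h4 := le_abs_self σ
    linarith
  refine abs_le.2 ⟨?_, ?_⟩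
  · have := key (-1) (by simp); linarith
  · have := key 1 (by simp); linarith

lemma abs_le_exp (hs : IsScalarSolution b lam s s') (hb : Assumption1 b b' ρ)
    (hlam : 0 < lam) {ω : ℝ} (hω : 1 ≤ ω)
    (hω' : 2 * (lam * ∫ v in Ioi 0, Real.exp (-1 * v) * b v) ≤ ω) {t : ℝ} (ht : 0 ≤ t) :
    |s t| ≤ 2 * Real.exp (ω * t) := by
  obtain ⟨u₀, hu₀, hmax⟩ := isCompact_Icc.exists_isMaxOn (s := Icc 0 t) ⟨0, le_rfl, ht⟩
    (f := fun u => |s u| * Real.exp (-(ω * u)))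
    ((hs.cont.mono Icc_subset_Ici_self).abs.mul (by fun_prop))
  set m := |s u₀| * Real.exp (-(ω * u₀)) with hm
  have hm0 : 0 ≤ m := by positivity
  have hbound : ∀ u ∈ Icc 0 t, |s u| ≤ m * Real.exp (ω * u) := by
    intro u hu
    have h1 : |s u| * Real.exp (-(ω * u)) ≤ m := hmax hu
    have h2 := mul_le_mul_of_nonneg_right h1 (Real.exp_nonneg (ω * u))
    rwa [mul_assoc, ← Real.exp_add, neg_add_cancel, Real.exp_zero, mul_one] at h2
  have hslope : ∀ u ∈ Ioo 0 u₀, |s' u| ≤ m / 2 * (ω * Real.exp (ω * u)) := by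
    intro u hu
    have h1 := hs.abs_slope_le_of_abs_le hb hlam hω hu.1 (m := m)
      fun v hv => hbound v ⟨hv.1, hv.2.trans (hu.2.le.trans hu₀.2)⟩
    have h2 : lam * (∫ v in Ioi 0, Real.exp (-1 * v) * b v) ≤ ω / 2 := by linarith
    calc _ ≤ _ := h1
      _ ≤ ω / 2 * m * Real.exp (ω * u) := by gcongr
      _ = _ := by ring
  have h5 := hs.abs_sub_le_of_abs_slope_le hu₀.1 hslope
  have h6 : m ≤ 2 := by
    have h7 : m * Real.exp (ω * u₀) = |s u₀| := by
      rw [hm, mul_assoc, ← Real.exp_add, neg_add_cancel, Real.exp_zero, mul_one]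
    have h8 : 1 ≤ Real.exp (ω * u₀) := Real.one_le_exp (mul_nonneg (by linarith) hu₀.1)
    nlinarith
  exact (hbound t ⟨ht, le_rfl⟩).trans (by gcongr)

lemma abs_slope_le_exp (hs : IsScalarSolution b lam s s') (hb : Assumption1 b b' ρ)
    (hlam : 0 < lam) {ω : ℝ} (hω : 1 ≤ ω)
    (hω' : 2 * (lam * ∫ v in Ioi 0, Real.exp (-1 * v) * b v) ≤ ω) {t : ℝ} (ht : 0 < t) :
    |s' t| ≤ lam * (∫ v in Ioi 0, Real.exp (-1 * v) * b v) * 2 * Real.exp (ω * t) :=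
  hs.abs_slope_le_of_abs_le hb hlam hω ht fun _ hu => hs.abs_le_exp hb hlam hω hω' hu.1

lemma continuousOn_slope (hs : IsScalarSolution b lam s s') (hb : Assumption1 b b' ρ) :
    ContinuousOn s' (Ioi 0) := by
  set S : ℝ → ℝ := fun u => s (max u 0) with hS
  have hScont : Continuous S := hs.cont.comp_continuous (by fun_prop) fun u => mem_Ici.2 (le_max_right _ _)
  have hform : ∀ t ∈ Ioi (0 : ℝ), s' t =
      -(lam * ∫ v in (0 : ℝ)..t, (Ioi 0).indicator b v * S (t - v)) := by
    intro t ht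
    have ht' : 0 < t := ht
    have h1 := hs.eqn t ht
    have h2 := intervalIntegral.integral_comp_sub_left (fun v => b v * s (t - v)) t
      (a := 0) (b := t)
    simp only [sub_sub_cancel, sub_self, sub_zero] at h2
    have h3 : ∫ v in (0 : ℝ)..t, (Ioi 0).indicator b v * S (t - v) =
        ∫ v in (0 : ℝ)..t, b v * s (t - v) := by
      rw [intervalIntegral.integral_of_le ht'.le, intervalIntegral.integral_of_le ht'.le]
      refine setIntegral_congr_fun measurableSet_Ioc fun v hv => ?_
      simp only [hS]
      rw [indicator_of_mem (show v ∈ Ioi (0 : ℝ) from hv.1), max_eq_left (by linarith [hv.2])]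
    rw [h3, ← h2]; linarith
  refine ContinuousOn.congr ?_ hform
  refine ContinuousOn.neg (ContinuousOn.const_mul ?_ _)
  intro t₀ ht₀
  have ht₀' : 0 < t₀ := ht₀
  refine ContinuousAt.continuousWithinAt ?_
  obtain ⟨C, hC⟩ := isCompact_Icc.exists_bound_of_continuousOn (s := Icc (-2) (t₀ + 2))
    hScont.continuousOn
  have hbint : IntegrableOn ((Ioi 0).indicator b) (Ioc (-1) (t₀ + 1)) := by
    rw [IntegrableOn, integrable_indicator_iff measurableSet_Ioi, IntegrableOn,
      Measure.restrict_restrict measurableSet_Ioi]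
    exact (hb.locInt (t₀ + 1) (by linarith)).mono_set fun v hv => ⟨hv.1, hv.2.2⟩
  have huIoc : uIoc (-1) (t₀ + 1) = Ioc (-1) (t₀ + 1) := uIoc_of_le (by linarith)
  have key := intervalIntegral.continuousAt_parametric_primitive_of_dominated (μ := volume)
    (F := fun t v => (Ioi 0).indicator b v * S (t - v))
    (fun v => ‖(Ioi 0).indicator b v‖ * C) (-1) (t₀ + 1) (a₀ := 0) (b₀ := t₀) (x₀ := t₀)
    (fun t => ?_) ?_ ?_ ?_ ⟨by norm_num, by linarith⟩ ⟨by linarith, by linarith⟩ (by simp)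
  · exact ContinuousAt.comp (f := fun t : ℝ => (t, t)) key (by fun_prop)
  · rw [huIoc]
    exact hbint.aestronglyMeasurable.mul
      (hScont.comp (continuous_const.sub continuous_id)).aestronglyMeasurable
  · rw [huIoc]
    filter_upwards [Ioo_mem_nhds (sub_one_lt t₀) (lt_add_one t₀)] with t ht
    refine (ae_restrict_mem measurableSet_Ioc).mono fun v hv => ?_
    rw [norm_mul]
    exact mul_le_mul_of_nonneg_left
      (hC _ ⟨by linarith [hv.2, ht.1], by linarith [hv.1, ht.2]⟩) (norm_nonneg _)
  · rw [intervalIntegrable_iff, huIoc]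
    exact hbint.norm.mul_const C
  · exact Eventually.of_forall fun v => by fun_prop

end IsScalarSolution

/-- Inversion of the Laplace transform at a point, along an absolutely convergent line. -/
lemma laplaceTransform_inversion {f : ℝ → ℝ} {σ : ℝ}
    (hf : IntegrableOn (fun t => Real.exp (-σ * t) * f t) (Ioi 0))
    (hcont : ContinuousOn f (Ioi 0))
    (hint : Integrable fun y : ℝ => laplaceTransform f (σ + y * Complex.I)) {t : ℝ} (ht : 0 < t) :
    ∫ y : ℝ, Complex.exp ((σ + y * Complex.I) * t) * laplaceTransform f (σ + y * Complex.I) =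
      2 * Real.pi * f t := by
  have hpi := Real.pi_pos
  set g : ℝ → ℂ := (Ioi 0).indicator fun t => ((Real.exp (-σ * t) * f t : ℝ) : ℂ) with hg
  have hgint : Integrable g := (integrable_indicator_iff measurableSet_Ioi).2 hf.ofReal
  have hF : FourierTransform.fourier g = fun ξ : ℝ =>
      laplaceTransform f (σ + (2 * Real.pi * ξ : ℝ) * Complex.I) := by
    ext ξ
    rw [Real.fourier_real_eq_integral_exp_smul, laplaceTransform,
      ← integral_indicator measurableSet_Ioi]
    refine integral_congr_ae (Eventually.of_forall fun v => ?_)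
    by_cases hv : v ∈ Ioi (0 : ℝ)
    · simp only [hg, indicator_of_mem hv, smul_eq_mul]
      push_cast
      rw [← mul_assoc, ← Complex.exp_add]
      congr 2; ring
    · simp only [hg, indicator_of_notMem hv, smul_zero]
  have hFint : Integrable (FourierTransform.fourier g) := by
    rw [hF]
    exact hint.comp_mul_left' (by positivity)
  have hgt : ContinuousAt g t := by
    have h1 : ContinuousAt (fun t => ((Real.exp (-σ * t) * f t : ℝ) : ℂ)) t :=
      Complex.continuous_ofReal.continuousAt.comp
        (ContinuousAt.mul (by fun_prop) (hcont.continuousAt (Ioi_mem_nhds ht)))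
    refine h1.congr ?_
    filter_upwards [Ioi_mem_nhds ht] with v hv
    exact (indicator_of_mem hv fun t => ((Real.exp (-σ * t) * f t : ℝ) : ℂ)).symm
  have key := hgint.fourierInv_fourier_eq hFint hgt
  rw [Real.fourierInv_eq', hF] at key
  have hgt' : g t = ((Real.exp (-σ * t) * f t : ℝ) : ℂ) := indicator_of_mem ht _
  rw [hgt'] at key
  have hscale := Measure.integral_comp_mul_left (fun y : ℝ => Complex.exp (y * t * Complex.I) *
    laplaceTransform f (σ + y * Complex.I)) (2 * Real.pi)
  have e1 : ∀ ξ : ℝ, Complex.exp (((2 * Real.pi * inner ℝ ξ t : ℝ) : ℂ) * Complex.I) •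
      laplaceTransform f (σ + (2 * Real.pi * ξ : ℝ) * Complex.I) =
      Complex.exp ((2 * Real.pi * ξ : ℝ) * t * Complex.I) *
        laplaceTransform f (σ + (2 * Real.pi * ξ : ℝ) * Complex.I) := by
    intro ξ
    rw [smul_eq_mul]
    congr 2
    simp
    ring
  simp only [e1] at key
  rw [hscale, abs_of_pos (show 0 < (2 * Real.pi)⁻¹ by positivity)] at key
  have e2 : ∀ y : ℝ, Complex.exp ((σ + y * Complex.I) * t) *
      laplaceTransform f (σ + y * Complex.I) = (Real.exp (σ * t) : ℂ) *
        (Complex.exp (y * t * Complex.I) * laplaceTransform f (σ + y * Complex.I)) := by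
    intro y
    push_cast
    rw [← mul_assoc, ← Complex.exp_add]
    congr 2; ring
  simp only [e2]
  rw [integral_const_mul]
  have h3 : ∫ y : ℝ, Complex.exp (y * t * Complex.I) * laplaceTransform f (σ + y * Complex.I) =
      2 * Real.pi * ((Real.exp (-σ * t) * f t : ℝ) : ℂ) := by
    rw [← key, Complex.real_smul, ← mul_assoc]
    have h5 : (2 * Real.pi : ℂ) * ((2 * Real.pi)⁻¹ : ℝ) = 1 := by
      push_cast
      exact mul_inv_cancel₀ (by exact_mod_cast (by positivity : (2 * Real.pi) ≠ 0))
    rw [h5, one_mul]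
  rw [h3]
  have h4 : (Real.exp (σ * t) : ℂ) * (Real.exp (-σ * t) : ℂ) = 1 := by
    rw [← Complex.ofReal_mul, ← Real.exp_add]; simp
  push_cast at h4 ⊢
  linear_combination (2 * Real.pi * f t : ℂ) * h4

/-- Shifting a vertical contour. -/
lemma integral_vertical_eq {F : ℂ → ℂ} {p q C : ℝ} (hpq : p ≤ q)
    (hF : DifferentiableOn ℂ F {z | p ≤ z.re ∧ z.re ≤ q})
    (hC : ∀ z : ℂ, p ≤ z.re → z.re ≤ q → ‖F z‖ ≤ C / (1 + |z.im|))
    (hp : Integrable fun y : ℝ => F (p + y * Complex.I))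
    (hq : Integrable fun y : ℝ => F (q + y * Complex.I)) :
    ∫ y : ℝ, F (p + y * Complex.I) = ∫ y : ℝ, F (q + y * Complex.I) := by
  have hrect : ∀ n : ℝ, (∫ x : ℝ in p..q, F (x + (-n : ℝ) * Complex.I)) -
      (∫ x : ℝ in p..q, F (x + n * Complex.I)) +
      Complex.I • (∫ y : ℝ in (-n)..n, F (q + y * Complex.I)) -
      Complex.I • (∫ y : ℝ in (-n)..n, F (p + y * Complex.I)) = 0 := by
    intro n
    have h := Complex.integral_boundary_rect_eq_zero_of_differentiableOn F
      (p + (-n : ℝ) * Complex.I) (q + n * Complex.I) (hF.mono ?_)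
    · simpa using h
    · intro z hz
      have h1 := hz.1
      simp only [mem_preimage, Complex.add_re, Complex.ofReal_re, Complex.mul_re, Complex.I_re,
        Complex.I_im, Complex.ofReal_im, mul_zero, zero_mul, sub_self, add_zero] at h1
      rwa [uIcc_of_le hpq] at h1
  have hside : ∀ ε : ℝ, |ε| = 1 →
      Tendsto (fun n : ℝ => ∫ x : ℝ in p..q, F (x + (ε * n : ℝ) * Complex.I)) atTop (nhds 0) := by
    intro ε hε
    refine squeeze_zero_norm' (a := fun n => C / (1 + n) * |q - p|) ?_ ?_
    · filter_upwards [eventually_ge_atTop 0] with n hn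
      refine intervalIntegral.norm_integral_le_of_norm_le_const fun x hx => ?_
      rw [uIoc_of_le hpq] at hx
      have h := hC (x + (ε * n : ℝ) * Complex.I) (by simpa using hx.1.le) (by simpa using hx.2)
      simpa [abs_mul, hε, abs_of_nonneg hn] using h
    · have h1 : Tendsto (fun n : ℝ => C / (1 + n)) atTop (nhds 0) :=
        (tendsto_atTop_add_const_left _ _ tendsto_id).const_div_atTop C
      simpa using h1.mul_const |q - p|
  have h1 := hside (-1) (by simp)
  have h2 := hside 1 (by simp)
  simp only [neg_mul, one_mul] at h1 h2
  have h3 := intervalIntegral_tendsto_integral hq tendsto_neg_atTop_atBot tendsto_id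
  have h4 := intervalIntegral_tendsto_integral hp tendsto_neg_atTop_atBot tendsto_id
  have h5 := ((h1.sub h2).add (h3.const_smul Complex.I)).sub (h4.const_smul Complex.I)
  have h6 := tendsto_nhds_unique h5 (tendsto_const_nhds.congr fun n => (hrect n).symm)
  rw [sub_zero, zero_add, sub_eq_zero] at h6
  exact (smul_right_injective ℂ Complex.I_ne_zero h6).symm

namespace IsScalarSolution

variable {b b' s s' : ℝ → ℝ} {ρ lam : ℝ}

lemma integrableOn_exp_mul_of_abs_le {f : ℝ → ℝ} {c ω σ : ℝ} (hf : ContinuousOn f (Ioi 0))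
    (hle : ∀ t > 0, |f t| ≤ c * Real.exp (ω * t)) (hσ : ω < σ) :
    IntegrableOn (fun t => Real.exp (-σ * t) * f t) (Ioi 0) := by
  have h1 : IntegrableOn (fun t => c * Real.exp (-(σ - ω) * t)) (Ioi 0) :=
    (exp_neg_integrableOn_Ioi 0 (sub_pos.2 hσ)).const_mul c
  refine Integrable.mono' h1
    ((ContinuousOn.mul (by fun_prop) hf).aestronglyMeasurable measurableSet_Ioi) ?_
  refine (ae_restrict_mem measurableSet_Ioi).mono fun t ht => ?_
  rw [norm_mul, Real.norm_of_nonneg (Real.exp_nonneg _), Real.norm_eq_abs]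
  calc _ ≤ Real.exp (-σ * t) * (c * Real.exp (ω * t)) := by gcongr; exact hle t ht
    _ = c * (Real.exp (-σ * t) * Real.exp (ω * t)) := by ring
    _ = _ := by rw [← Real.exp_add]; ring_nf

/-- The exponential growth bound, and integrability at a larger exponent. -/
lemma exists_integrableOn (hs : IsScalarSolution b lam s s') (hb : Assumption1 b b' ρ)
    (hlam : 0 < lam) : ∃ ω > (1 : ℝ), (∀ t ≥ 0, |s t| ≤ 2 * Real.exp (ω * t)) ∧
      ∀ σ > ω, IntegrableOn (fun t => Real.exp (-σ * t) * s t) (Ioi 0) ∧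
        IntegrableOn (fun t => Real.exp (-σ * t) * s' t) (Ioi 0) := by
  have hβ : 0 ≤ ∫ v in Ioi 0, Real.exp (-1 * v) * b v :=
    setIntegral_nonneg measurableSet_Ioi fun v hv =>
      mul_nonneg (Real.exp_nonneg _) (hb.nonneg v hv)
  have h0 : 0 ≤ 2 * (lam * ∫ v in Ioi 0, Real.exp (-1 * v) * b v) := by positivity
  set ω := 2 + 2 * (lam * ∫ v in Ioi 0, Real.exp (-1 * v) * b v) with hω
  have h1 : 1 ≤ ω := by linarith
  have h2 : 2 * (lam * ∫ v in Ioi 0, Real.exp (-1 * v) * b v) ≤ ω := by linarith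
  refine ⟨ω, by linarith, fun t ht => hs.abs_le_exp hb hlam h1 h2 ht, fun σ hσ => ⟨?_, ?_⟩⟩
  · exact integrableOn_exp_mul_of_abs_le (hs.cont.mono Ioi_subset_Ici_self)
      (fun t ht => hs.abs_le_exp hb hlam h1 h2 (le_of_lt ht)) hσ
  · exact integrableOn_exp_mul_of_abs_le (hs.continuousOn_slope hb)
      (fun t ht => hs.abs_slope_le_exp hb hlam h1 h2 ht) hσ

lemma laplaceTransform_slope_eq (hs : IsScalarSolution b lam s s') {ω σ : ℝ}
    (hgrow : ∀ t ≥ 0, |s t| ≤ 2 * Real.exp (ω * t)) (hωσ : ω < σ)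
    (h1 : IntegrableOn (fun t => Real.exp (-σ * t) * s t) (Ioi 0))
    (h2 : IntegrableOn (fun t => Real.exp (-σ * t) * s' t) (Ioi 0)) {z : ℂ} (hz : σ ≤ z.re) :
    laplaceTransform s' z = z * laplaceTransform s z - 1 := by
  have i1 := (integrableOn_cexp_mul h1 hz).const_mul (-z)
  have i2 := integrableOn_cexp_mul h2 hz
  have hcE : Continuous fun t : ℝ => Complex.exp (-z * t) := by fun_prop
  have key := integral_Ioi_of_hasDerivAt_of_tendsto (a := 0) (m := 0)
    (f := fun t : ℝ => Complex.exp (-z * t) * (s t : ℂ))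
    (f' := fun t : ℝ => -z * (Complex.exp (-z * t) * (s t : ℂ)) +
      Complex.exp (-z * t) * (s' t : ℂ)) ?_ ?_ (i1.add i2) ?_
  · rw [integral_add i1 i2, integral_const_mul] at key
    simp only [Complex.ofReal_zero, mul_zero, Complex.exp_zero, hs.init, Complex.ofReal_one,
      mul_one] at key
    unfold laplaceTransform
    linear_combination key
  · exact (hcE.continuousOn.mul (Complex.continuous_ofReal.comp_continuousOn hs.cont)) 0
      self_mem_Ici
  · intro t ht
    have hE : HasDerivAt (fun t : ℝ => Complex.exp (-z * t)) (Complex.exp (-z * t) * (-z * 1)) t :=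
      ((Complex.ofRealCLM.hasDerivAt (x := t)).const_mul (-z)).cexp
    exact (hE.mul (hs.hasDeriv t ht).ofReal_comp).congr_deriv (by ring)
  · refine squeeze_zero_norm' (a := fun t => 2 * Real.exp (-(σ - ω) * t)) ?_ ?_
    · filter_upwards [eventually_ge_atTop 0] with t ht
      rw [norm_mul, norm_cexp_neg_mul, Complex.norm_real, Real.norm_eq_abs]
      calc _ ≤ Real.exp (-σ * t) * (2 * Real.exp (ω * t)) := by
            gcongr
            exact hgrow t ht
        _ = 2 * (Real.exp (-σ * t) * Real.exp (ω * t)) := by ring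
        _ = _ := by rw [← Real.exp_add]; ring_nf
    · have h3 : Tendsto (fun t => -(σ - ω) * t) atTop atBot :=
        tendsto_id.const_mul_atTop_of_neg (by linarith)
      simpa using (Real.tendsto_exp_atBot.comp h3).const_mul 2

lemma laplaceTransform_slope_eq_mul (hs : IsScalarSolution b lam s s') {z : ℂ}
    (hbz : IntegrableOn (fun t : ℝ => Complex.exp (-z * t) * (b t : ℂ)) (Ioi 0))
    (hsz : IntegrableOn (fun t : ℝ => Complex.exp (-z * t) * (s t : ℂ)) (Ioi 0)) :
    laplaceTransform s' z = -(lam * (laplaceTransform s z * laplaceTransform b z)) := by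
  have key := integral_posConvolution hsz hbz (ContinuousLinearMap.mul ℝ ℂ)
  simp only [ContinuousLinearMap.mul_apply'] at key
  unfold laplaceTransform
  rw [← key, ← integral_const_mul, ← integral_neg]
  refine setIntegral_congr_fun measurableSet_Ioi fun t ht => ?_
  have h1 : s' t = -(lam * ∫ u in (0 : ℝ)..t, b (t - u) * s u) := by
    have := hs.eqn t ht; linarith
  have h2 : ∀ u : ℝ, Complex.exp (-z * u) * (s u : ℂ) *
      (Complex.exp (-z * (t - u : ℝ)) * (b (t - u) : ℂ)) =
      Complex.exp (-z * t) * ((b (t - u) * s u : ℝ) : ℂ) := by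
    intro u
    have : Complex.exp (-z * t) = Complex.exp (-z * u) * Complex.exp (-z * (t - u : ℝ)) := by
      rw [← Complex.exp_add]; push_cast; ring_nf
    rw [this]; push_cast; ring
  simp only [h2]
  rw [intervalIntegral.integral_const_mul, intervalIntegral.integral_ofReal, h1]
  push_cast; ring

lemma laplaceTransform_slope (hs : IsScalarSolution b lam s s') (hb : Assumption1 b b' ρ)
    (hlam : 0 < lam) : ∃ ω > (1 : ℝ),
      (∀ σ > ω, IntegrableOn (fun t => Real.exp (-σ * t) * s' t) (Ioi 0)) ∧
      ∀ z : ℂ, ω < z.re → laplaceTransform s' z = slopeSymbol b lam z := by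
  obtain ⟨ω, hω, hgrow, hint⟩ := hs.exists_integrableOn hb hlam
  refine ⟨ω, hω, fun σ hσ => (hint σ hσ).2, fun z hz => ?_⟩
  obtain ⟨h1, h2⟩ := hint z.re hz
  have hz0 : 0 < z.re := by linarith
  have e1 := hs.laplaceTransform_slope_eq hgrow hz h1 h2 le_rfl
  have e2 := hs.laplaceTransform_slope_eq_mul
    (integrableOn_cexp_mul (hb.integrableOn_exp_mul hz0) le_rfl) (integrableOn_cexp_mul h1 le_rfl)
  obtain ⟨κ, -, hden⟩ := hb.exists_norm_denom
  have hne := (hden lam hlam z hz0).2.2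
  rw [slopeSymbol, eq_div_iff hne]
  have e3 : (z + lam * laplaceTransform b z) * laplaceTransform s z = 1 := by
    linear_combination e2 - e1
  rw [e2]
  linear_combination (-lam * laplaceTransform b z) * e3

/-- `t s'(t)` is the inverse Laplace transform of `-slopeSymbolDeriv` on the line `Re z = 1`. -/
lemma integral_slopeSymbolDeriv_eq (hs : IsScalarSolution b lam s s') (hb : Assumption1 b b' ρ)
    (hlam : 0 < lam) {t : ℝ} (ht : 0 < t) :
    ∫ y : ℝ, Complex.exp (((1 : ℝ) + y * Complex.I) * t) *
      slopeSymbolDeriv b lam ((1 : ℝ) + y * Complex.I) = -(2 * Real.pi * (t * s' t : ℝ)) := by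
  obtain ⟨ω, hω, hint, hL⟩ := hs.laplaceTransform_slope hb hlam
  set σ := ω + 1 with hσ
  have hopen : IsOpen {z : ℂ | ω < z.re} := isOpen_lt continuous_const Complex.continuous_re
  have hLt : ∀ z : ℂ, ω < z.re →
      laplaceTransform (fun t => t * s' t) z = -slopeSymbolDeriv b lam z := by
    intro z hz
    obtain ⟨τ, h1, h2⟩ := exists_between hz
    have d1 := hasDerivAt_laplaceTransform (hint τ h1) h2
    have d2 := (hb.hasDerivAt_slopeSymbol hlam (z := z) (by linarith)).congr_of_eventuallyEq
      (f₁ := laplaceTransform s') (by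
        filter_upwards [hopen.mem_nhds hz] with w hw using hL w hw)
    rw [← d1.unique d2, neg_neg]
  have hcD : ∀ x : ℝ, 0 < x → Continuous fun y : ℝ => slopeSymbolDeriv b lam (x + y * Complex.I) :=
    fun x hx => (hb.differentiableOn_slopeSymbolDeriv hlam).continuousOn.comp_continuous
      (by fun_prop) fun y => by simpa using hx
  have hintD : ∀ x : ℝ, 1 ≤ x →
      Integrable fun y : ℝ => slopeSymbolDeriv b lam (x + y * Complex.I) := by
    intro x hx
    obtain ⟨C, -, hC⟩ := hb.exists_norm_slopeSymbolDeriv_le hx (δ := 1 / 2) (by norm_num)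
      (by norm_num)
    have h1 : Integrable fun y : ℝ => (1 + ‖y‖) ^ (-(1 + 1 / 2 : ℝ)) :=
      integrable_one_add_norm (by simp)
    refine Integrable.mono' (h1.const_mul (C * lam ^ (1 / 2 : ℝ)))
      (hcD x (by linarith)).aestronglyMeasurable (Eventually.of_forall fun y => ?_)
    simpa using hC lam hlam (x + y * Complex.I) (by simp)
  have hintE : ∀ x : ℝ, 1 ≤ x → Integrable fun y : ℝ =>
      Complex.exp ((x + y * Complex.I) * t) * slopeSymbolDeriv b lam (x + y * Complex.I) := by
    intro x hx
    refine (hintD x hx).bdd_mul (c := Real.exp (x * t)) (by fun_prop)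
      (Eventually.of_forall fun y => ?_)
    rw [Complex.norm_exp]; simp
  have hshift := integral_vertical_eq (p := 1) (q := σ)
    (F := fun z => Complex.exp (z * t) * slopeSymbolDeriv b lam z)
    (C := Real.exp (σ * t) * (hb.exists_norm_slopeSymbolDeriv_le_inv hlam).choose)
    (by linarith) ?_ ?_ (hintE 1 le_rfl) (hintE σ (by linarith))
  · rw [hshift]
    have h1 : ∀ y : ℝ, ω < (σ + y * Complex.I : ℂ).re := fun y => by simp [hσ]
    have hinv := laplaceTransform_inversion (f := fun t => t * s' t) (σ := σ)
      (integrableOn_exp_mul_id_mul (hint (ω + 1 / 2) (by linarith)) (by linarith))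
      (continuousOn_id.mul (hs.continuousOn_slope hb))
      ((hintD σ (by linarith)).neg.congr (Eventually.of_forall fun y => (hLt _ (h1 y)).symm)) ht
    rw [← hinv, ← integral_neg]
    refine integral_congr_ae (Eventually.of_forall fun y => ?_)
    simp only [hLt _ (h1 y)]
    ring
  · refine DifferentiableOn.mul (by fun_prop)
      ((hb.differentiableOn_slopeSymbolDeriv hlam).mono fun z hz => ?_)
    exact one_pos.trans_le hz.1
  · intro z h1 h2
    have h3 := (hb.exists_norm_slopeSymbolDeriv_le_inv hlam).choose_spec.2 z h1
    rw [norm_mul, mul_div_assoc]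
    refine mul_le_mul ?_ h3 (norm_nonneg _) (Real.exp_nonneg _)
    rw [Complex.norm_exp]
    have : (z * t).re = z.re * t := by simp
    rw [this]
    gcongr

end IsScalarSolution

/-- The smoothing estimate for the derivative of the scalar solutions, up to a factor `λ^δ`. -/
lemma Assumption1.exists_mul_abs_slope_le {b b' : ℝ → ℝ} {ρ δ : ℝ} (hb : Assumption1 b b' ρ)
    (hδ : 0 < δ) (hδ1 : δ < 1) : ∃ C > (0 : ℝ), ∀ lam > (0 : ℝ), ∀ s s' : ℝ → ℝ,
      IsScalarSolution b lam s s' →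
      ∀ t > 0, t * |s' t| ≤ C * lam ^ δ * Real.exp t := by
  obtain ⟨C, hC, hle⟩ := hb.exists_norm_slopeSymbolDeriv_le le_rfl hδ hδ1
  have hI : Integrable fun y : ℝ => (1 + ‖y‖) ^ (-(1 + δ)) :=
    integrable_one_add_norm (by simpa using hδ)
  set I := ∫ y : ℝ, (1 + ‖y‖) ^ (-(1 + δ))
  have hI0 : 0 ≤ I := integral_nonneg fun y => by positivity
  refine ⟨C * (I + 1), by positivity, fun lam hlam s s' hs t ht => ?_⟩
  have h1 : ‖∫ y : ℝ, Complex.exp (((1 : ℝ) + y * Complex.I) * t) *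
      slopeSymbolDeriv b lam ((1 : ℝ) + y * Complex.I)‖ ≤
      ∫ y : ℝ, Real.exp t * (C * lam ^ δ) * (1 + ‖y‖) ^ (-(1 + δ)) := by
    refine norm_integral_le_of_norm_le (hI.const_mul _) (Eventually.of_forall fun y => ?_)
    have h2 := hle lam hlam ((1 : ℝ) + y * Complex.I) (by simp)
    have h3 : ‖Complex.exp (((1 : ℝ) + y * Complex.I) * t)‖ = Real.exp t := by
      rw [Complex.norm_exp]; simp
    rw [norm_mul, h3, mul_assoc (Real.exp t)]
    refine mul_le_mul_of_nonneg_left ?_ (Real.exp_nonneg _)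
    simpa using h2
  rw [hs.integral_slopeSymbolDeriv_eq hb hlam ht, integral_const_mul, norm_neg, norm_mul, norm_mul,
    Complex.norm_real, Complex.norm_real, Real.norm_of_nonneg Real.pi_pos.le, Real.norm_eq_abs,
    abs_mul, abs_of_pos ht, Complex.norm_ofNat] at h1
  have h4 : 1 ≤ 2 * Real.pi := by linarith [Real.pi_gt_three]
  have h5 : 0 ≤ t * |s' t| := by positivity
  calc t * |s' t| ≤ 2 * Real.pi * (t * |s' t|) := le_mul_of_one_le_left h5 h4
    _ ≤ Real.exp t * (C * lam ^ δ) * I := h1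
    _ ≤ Real.exp t * (C * lam ^ δ) * (I + 1) := by gcongr; linarith
    _ = _ := by ring

lemma rpow_le_mul_rpow_of_le {l₀ l p q : ℝ} (hl₀ : 0 < l₀) (hl : l₀ ≤ l) (hpq : p ≤ q) :
    l ^ p ≤ l₀ ^ (p - q) * l ^ q := by
  have hl' : 0 < l := hl₀.trans_le hl
  calc l ^ p = l ^ (p - q) * l ^ q := by rw [← Real.rpow_add hl', sub_add_cancel]
    _ ≤ _ := by
      gcongr ?_ * _
      exact Real.rpow_le_rpow_of_nonpos hl₀ hl (by linarith)

/-- The derivative of the scalar solutions is integrable at the origin, at the cost of an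
arbitrarily small power of `λ`. -/
lemma Assumption1.exists_abs_slope_le {b b' : ℝ → ℝ} {ρ ε T l₀ : ℝ} (hb : Assumption1 b b' ρ)
    (hε : 0 < ε) (hl₀ : 0 < l₀) : ∃ C > (0 : ℝ), ∃ η > (0 : ℝ), ∀ lam ≥ l₀,
      ∀ s s' : ℝ → ℝ, IsScalarSolution b lam s s' →
      ∀ t ∈ Ioc 0 T, |s' t| ≤ C * lam ^ ε * t ^ (η - 1) := by
  set δ := min ε 1 / 2 with hδ
  have hδ0 : 0 < δ := by positivity
  have hδ1 : δ < 1 := by linarith [min_le_right ε 1]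
  have hδε : 2 * δ ≤ ε := by linarith [min_le_left ε 1]
  obtain ⟨C, hC, hbound⟩ := hb.exists_mul_abs_slope_le hδ0 hδ1
  set β := ∫ v in Ioi 0, Real.exp (-1 * v) * b v with hβ
  have hβ0 : 0 ≤ β := setIntegral_nonneg measurableSet_Ioi fun v hv =>
    mul_nonneg (Real.exp_nonneg _) (hb.nonneg v hv)
  set D := 2 * β + 1 / l₀ with hD
  have hD0 : 0 < D := by positivity
  refine ⟨Real.exp 1 * D ^ δ * l₀ ^ (δ - ε) +
    C * Real.exp T * D ^ δ * l₀ ^ (2 * δ - ε), by positivity, δ, hδ0, ?_⟩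
  intro lam hlam s s' hs t ht
  have ht0 : 0 < t := ht.1
  have hlam0 : 0 < lam := hl₀.trans_le hlam
  have h1 : 1 ≤ D * lam := by
    have h2 : 1 ≤ 1 / l₀ * lam := by rw [div_mul_eq_mul_div, one_mul, one_le_div hl₀]; exact hlam
    have : 0 ≤ β * lam := by positivity
    rw [hD, add_mul]; linarith
  have h2 : 2 * (lam * β) ≤ D * lam := by
    have : 0 ≤ 1 / l₀ * lam := by positivity
    rw [hD, add_mul]; linarith
  have hDl : 0 < D * lam := by positivity
  have hA : 0 ≤ C * Real.exp T * D ^ δ * l₀ ^ (2 * δ - ε) * lam ^ ε * t ^ (δ - 1) := by positivity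
  have hB : 0 ≤ Real.exp 1 * D ^ δ * l₀ ^ (δ - ε) * lam ^ ε * t ^ (δ - 1) := by positivity
  rcases le_total (D * lam * t) 1 with hsmall | hlarge
  · have h3 : |s' t| ≤ lam * β * 2 * Real.exp (D * lam * t) :=
      hs.abs_slope_le_exp hb hlam0 h1 h2 ht0
    have h4 : D * lam ≤ t ^ (δ - 1) * (D ^ δ * lam ^ δ) := by
      have h5 : D * lam ≤ t⁻¹ := by rwa [← one_div, le_div_iff₀ ht0]
      calc D * lam = (D * lam) ^ (1 - δ) * (D * lam) ^ δ := by
            rw [← Real.rpow_add hDl]; norm_num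
        _ ≤ t⁻¹ ^ (1 - δ) * (D * lam) ^ δ := by
            gcongr
        _ = _ := by
            rw [Real.inv_rpow ht0.le, ← Real.rpow_neg ht0.le, neg_sub,
              Real.mul_rpow hD0.le hlam0.le]
    have h6 : |s' t| ≤ Real.exp 1 * D ^ δ * l₀ ^ (δ - ε) * lam ^ ε * t ^ (δ - 1) := by
      calc |s' t| ≤ lam * β * 2 * Real.exp (D * lam * t) := h3
        _ ≤ D * lam * Real.exp 1 :=
            mul_le_mul (by linarith) (Real.exp_le_exp.2 hsmall) (Real.exp_nonneg _) hDl.le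
        _ ≤ t ^ (δ - 1) * (D ^ δ * lam ^ δ) * Real.exp 1 := by gcongr
        _ ≤ t ^ (δ - 1) * (D ^ δ * (l₀ ^ (δ - ε) * lam ^ ε)) * Real.exp 1 := by
            gcongr; exact rpow_le_mul_rpow_of_le hl₀ hlam (by linarith)
        _ = _ := by ring
    linarith
  · have h3 := hbound lam hlam0 s s' hs t ht0
    have h4 : t⁻¹ ≤ t ^ (δ - 1) * (D ^ δ * lam ^ δ) := by
      calc t⁻¹ = t⁻¹ * 1 := (mul_one _).symm
        _ ≤ t⁻¹ * (D * lam * t) ^ δ := by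
            gcongr; exact Real.one_le_rpow hlarge hδ0.le
        _ = _ := by
            rw [Real.mul_rpow hDl.le ht0.le, Real.mul_rpow hD0.le hlam0.le, Real.rpow_sub_one ht0.ne']
            ring
    have h5 : |s' t| ≤ C * Real.exp T * D ^ δ * l₀ ^ (2 * δ - ε) * lam ^ ε * t ^ (δ - 1) := by
      calc |s' t| = t⁻¹ * (t * |s' t|) := by field_simp
        _ ≤ t⁻¹ * (C * lam ^ δ * Real.exp T) := by
            refine mul_le_mul_of_nonneg_left (h3.trans ?_) (by positivity)
            gcongr; exact ht.2
        _ ≤ t ^ (δ - 1) * (D ^ δ * lam ^ δ) * (C * lam ^ δ * Real.exp T) := by gcongr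
        _ = t ^ (δ - 1) * D ^ δ * C * Real.exp T * (lam ^ δ * lam ^ δ) := by ring
        _ = t ^ (δ - 1) * D ^ δ * C * Real.exp T * lam ^ (2 * δ) := by
            rw [← Real.rpow_add hlam0, two_mul]
        _ ≤ t ^ (δ - 1) * D ^ δ * C * Real.exp T * (l₀ ^ (2 * δ - ε) * lam ^ ε) := by
            gcongr; exact rpow_le_mul_rpow_of_le hl₀ hlam hδε
        _ = _ := by ring
    linarith

/-- `∫₀ᵀ ‖Ṡ(u)x‖₂ du ≤ C ‖x‖_{2+2ε}`, in the spectral (Parseval) form. -/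
theorem statement10 {H : Type*} [NormedAddCommGroup H] [InnerProductSpace ℝ H]
    [CompleteSpace H]
    (b b' : ℝ → ℝ) (ρ : ℝ) (hb : Assumption1 b b' ρ)
    (e : HilbertBasis ℕ ℝ H) (lam : ℕ → ℝ)
    (hlam_pos : ∀ k, 0 < lam k) (hlam_mono : Monotone lam)
    (hlam_top : Tendsto lam atTop atTop)
    (s s' : ℕ → ℝ → ℝ) (hs : ∀ k, IsScalarSolution b (lam k) (s k) (s' k))
    (ε T : ℝ) (hε : 0 < ε) (hT : 0 < T) :
    ∃ C > 0, ∀ x : H,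
      (∑' k, ENNReal.ofReal (lam k ^ (2 + 2 * ε) * ⟪x, e k⟫ ^ 2)) < ⊤ →
      (∫⁻ u in Set.Ioc (0 : ℝ) T,
          (∑' k, ENNReal.ofReal (lam k ^ 2 * (s' k u) ^ 2 * ⟪x, e k⟫ ^ 2)) ^ (1/2 : ℝ)) ≤
        ENNReal.ofReal C *
          (∑' k, ENNReal.ofReal (lam k ^ (2 + 2 * ε) * ⟪x, e k⟫ ^ 2)) ^ (1/2 : ℝ) := by
  obtain ⟨C, hC, η, hη, hbound⟩ := hb.exists_abs_slope_le (T := T) hε (hlam_pos 0)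
  have hint : IntegrableOn (fun u : ℝ => C * u ^ (η - 1)) (Ioc 0 T) := by
    have h1 := intervalIntegral.intervalIntegrable_rpow' (a := 0) (b := T)
      (show -1 < η - 1 by linarith)
    exact ((intervalIntegrable_iff_integrableOn_Ioc_of_le hT.le).1 h1).const_mul C
  have hnn : 0 ≤ᵐ[volume.restrict (Ioc 0 T)] fun u : ℝ => C * u ^ (η - 1) :=
    (ae_restrict_mem measurableSet_Ioc).mono fun u hu =>
      mul_nonneg hC.le (Real.rpow_nonneg hu.1.le _)
  have hI0 : 0 ≤ ∫ u in Ioc 0 T, C * u ^ (η - 1) := integral_nonneg_of_ae hnn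
  refine ⟨(∫ u in Ioc 0 T, C * u ^ (η - 1)) + 1, by positivity, fun x _ => ?_⟩
  set N := ∑' k, ENNReal.ofReal (lam k ^ (2 + 2 * ε) * ⟪x, e k⟫ ^ 2)
  have hpt : ∀ u ∈ Ioc 0 T,
      (∑' k, ENNReal.ofReal (lam k ^ 2 * (s' k u) ^ 2 * ⟪x, e k⟫ ^ 2)) ^ (1/2 : ℝ) ≤
        ENNReal.ofReal (C * u ^ (η - 1)) * N ^ (1/2 : ℝ) := by
    intro u hu
    have hp : 0 ≤ C * u ^ (η - 1) := mul_nonneg hC.le (Real.rpow_nonneg hu.1.le _)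
    have hterm : ∀ k, ENNReal.ofReal (lam k ^ 2 * (s' k u) ^ 2 * ⟪x, e k⟫ ^ 2) ≤
        ENNReal.ofReal (C * u ^ (η - 1)) ^ (2 : ℝ) *
          ENNReal.ofReal (lam k ^ (2 + 2 * ε) * ⟪x, e k⟫ ^ 2) := by
      intro k
      have h1 := hbound (lam k) (hlam_mono k.zero_le) (s k) (s' k) (hs k) u hu
      have h2 : (s' k u) ^ 2 ≤ (C * lam k ^ ε * u ^ (η - 1)) ^ 2 := by
        rw [← sq_abs]; gcongr
      have h3 : lam k ^ (2 + 2 * ε) = lam k ^ 2 * (lam k ^ ε) ^ 2 := by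
        rw [Real.rpow_add (hlam_pos k), Real.rpow_two, two_mul, Real.rpow_add (hlam_pos k), sq, sq]
      rw [ENNReal.ofReal_rpow_of_nonneg hp two_pos.le, ← ENNReal.ofReal_mul (by positivity),
        Real.rpow_two, h3]
      refine ENNReal.ofReal_le_ofReal ?_
      calc _ ≤ lam k ^ 2 * (C * lam k ^ ε * u ^ (η - 1)) ^ 2 * ⟪x, e k⟫ ^ 2 := by gcongr
        _ = _ := by ring
    calc _ ≤ (∑' k, ENNReal.ofReal (C * u ^ (η - 1)) ^ (2 : ℝ) *
          ENNReal.ofReal (lam k ^ (2 + 2 * ε) * ⟪x, e k⟫ ^ 2)) ^ (1/2 : ℝ) :=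
          ENNReal.rpow_le_rpow (ENNReal.tsum_le_tsum hterm) (by norm_num)
      _ = _ := by
          rw [ENNReal.tsum_mul_left, ENNReal.mul_rpow_of_nonneg _ _ (by norm_num),
            ← ENNReal.rpow_mul]
          norm_num [N]
  calc _ ≤ ∫⁻ u in Ioc 0 T, ENNReal.ofReal (C * u ^ (η - 1)) * N ^ (1/2 : ℝ) :=
        setLIntegral_mono' measurableSet_Ioc hpt
    _ = ENNReal.ofReal (∫ u in Ioc 0 T, C * u ^ (η - 1)) * N ^ (1/2 : ℝ) := by
        rw [lintegral_mul_const _ (by fun_prop), ofReal_integral_eq_lintegral_ofReal hint hnn]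
    _ ≤ _ := by
        gcongr
        linarith
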